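/- arXiv:2310.14080 — 2 statements merged into one kernel-verified Lean document; each statement's English description precedes it below -/
import Mathlib

section
/- Let n ∈ {48, 56, 64} and let C be a Type II Z4-code of length n. Then C is extremal if and only if the lattice A₄(C) has minimum norm 4 and kissing number 2n, i.e., min{⟨x,x⟩ : x ∈ A₄(C), x ≠ 0} = 4 and the set {x ∈ A₄(C) : ⟨x,x⟩ = 4} has exactly 2n elements. -/
open Finset

def z4Inner {n : ℕ} (x y : Fin n → ZMod 4) : ZMod 4 := ∑ i, x i * y i

def z4Dual {n : ℕ} (C : Set (Fin n → ZMod 4)) : Set (Fin n → ZMod 4) :=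
  {x | ∀ c ∈ C, z4Inner x c = 0}

def IsSelfDualZ4 {n : ℕ} (C : Set (Fin n → ZMod 4)) : Prop := C = z4Dual C

def euclWt {n : ℕ} (x : Fin n → ZMod 4) : ℕ :=
  ∑ i, (if x i = 0 then 0 else if x i = 2 then 4 else 1)

def IsTypeIIZ4 {n : ℕ} (C : Set (Fin n → ZMod 4)) : Prop :=
  IsSelfDualZ4 C ∧ ∀ c ∈ C, 8 ∣ euclWt c

def IsExtremalTypeIIZ4 (n : ℕ) (C : Set (Fin n → ZMod 4)) : Prop :=
  IsTypeIIZ4 C ∧ sInf (euclWt '' (C \ {0})) = 8 * (n / 24) + 8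

def IsEvenVec {n : ℕ} (x : Fin n → ZMod 4) : Prop := ∀ i, x i = 0 ∨ x i = 2

def Sset {n : ℕ} (w : Fin n → ZMod 4) (a : ZMod 4) : Finset (Fin n) :=
  Finset.univ.filter (fun j => w j = a)

def doubled {n : ℕ} (C : Set (Fin n → ZMod 4)) (tu : Fin n → ZMod 4) :
    Set (Fin n → ZMod 4) :=
  {w | ∃ v ∈ C, z4Inner tu v = 0 ∧ ∃ a : ZMod 4, w = v + a • tu}

def bInner {n : ℕ} (x y : Fin n → ZMod 2) : ZMod 2 := ∑ i, x i * y i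

def bDual {n : ℕ} (D : Set (Fin n → ZMod 2)) : Set (Fin n → ZMod 2) :=
  {x | ∀ y ∈ D, bInner x y = 0}

def hWt {n : ℕ} (x : Fin n → ZMod 2) : ℕ := (Finset.univ.filter fun i => x i ≠ 0).card

def IsTypeIIBin {n : ℕ} (D : Set (Fin n → ZMod 2)) : Prop :=
  D = bDual D ∧ ∀ y ∈ D, 4 ∣ hWt y

def IsExtremalTypeIIBin (n : ℕ) (D : Set (Fin n → ZMod 2)) : Prop :=
  IsTypeIIBin D ∧ sInf (hWt '' (D \ {0})) = 4 * (n / 24) + 4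

def residueSet {n : ℕ} (C : Set (Fin n → ZMod 4)) : Set (Fin n → ZMod 2) :=
  {y | ∃ c ∈ C, y = fun i => ZMod.castHom (by norm_num : (2:ℕ) ∣ 4) (ZMod 2) (c i)}

def torsionSet {n : ℕ} (C : Set (Fin n → ZMod 4)) : Set (Fin n → ZMod 2) :=
  {c | (fun i => 2 * ((c i).val : ZMod 4)) ∈ C}

def rInner {n : ℕ} (x y : Fin n → ℝ) : ℝ := ∑ i, x i * y i

def A4lattice {n : ℕ} (C : Set (Fin n → ZMod 4)) : Set (Fin n → ℝ) :=
  {x | ∃ z : Fin n → ℤ, (∀ i, 2 * x i = (z i : ℝ)) ∧ (fun i => (z i : ZMod 4)) ∈ C}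

def dualLattice {n : ℕ} (L : Set (Fin n → ℝ)) : Set (Fin n → ℝ) :=
  {y | ∀ x ∈ L, ∃ m : ℤ, rInner x y = (m : ℝ)}

def IsIntegralLattice {n : ℕ} (L : Set (Fin n → ℝ)) : Prop :=
  ∀ x ∈ L, ∀ y ∈ L, ∃ m : ℤ, rInner x y = (m : ℝ)

def IsEvenLattice {n : ℕ} (L : Set (Fin n → ℝ)) : Prop :=
  IsIntegralLattice L ∧ ∀ x ∈ L, ∃ m : ℤ, rInner x x = 2 * (m : ℝ)

def IsUnimodularLattice {n : ℕ} (L : Set (Fin n → ℝ)) : Prop :=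
  IsIntegralLattice L ∧ L = dualLattice L

def MonomiallyEquiv {n : ℕ} (C D : Set (Fin n → ZMod 4)) : Prop :=
  ∃ (σ : Equiv.Perm (Fin n)) (ε : Fin n → ZMod 4), (∀ i, ε i = 1 ∨ ε i = 3) ∧
    D = (fun x => fun i => ε i * x (σ i)) '' C


/-! ### Symmetrized weight enumerator -/

/-- symmetrized weight of a symbol -/
def sw (a b c : ℂ) (s : ZMod 4) : ℂ := if s = 0 then a else if s = 2 then c else b

def cnt0 {n : ℕ} (v : Fin n → ZMod 4) : ℕ := ∑ i, (if v i = 0 then 1 else 0)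
def cnt1 {n : ℕ} (v : Fin n → ZMod 4) : ℕ := ∑ i, (if v i = 0 then 0 else if v i = 2 then 0 else 1)
def cnt2 {n : ℕ} (v : Fin n → ZMod 4) : ℕ := ∑ i, (if v i = 2 then 1 else 0)

lemma cnt_sum {n : ℕ} (v : Fin n → ZMod 4) : cnt0 v + cnt1 v + cnt2 v = n := by
  unfold cnt0 cnt1 cnt2
  rw [← Finset.sum_add_distrib, ← Finset.sum_add_distrib]
  rw [Finset.sum_congr rfl (g := fun _ => 1)]
  · simp
  · intro i _
    generalize v i = s
    revert s; decide

lemma euclWt_eq {n : ℕ} (v : Fin n → ZMod 4) : euclWt v = cnt1 v + 4 * cnt2 v := by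
  unfold euclWt cnt1 cnt2
  rw [Finset.mul_sum, ← Finset.sum_add_distrib]
  refine Finset.sum_congr rfl fun i _ => ?_
  generalize v i = s
  revert s; decide

lemma prod_sw {n : ℕ} (a b c : ℂ) (v : Fin n → ZMod 4) :
    ∏ i, sw a b c (v i) = a ^ cnt0 v * b ^ cnt1 v * c ^ cnt2 v := by
  unfold cnt0 cnt1 cnt2
  rw [← Finset.prod_pow_eq_pow_sum, ← Finset.prod_pow_eq_pow_sum, ← Finset.prod_pow_eq_pow_sum,
    ← Finset.prod_mul_distrib, ← Finset.prod_mul_distrib]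
  refine Finset.prod_congr rfl fun i _ => ?_
  have h02 : ¬ ((0 : ZMod 4) = 2) := by decide
  unfold sw
  by_cases h0 : v i = 0
  · simp [h0, h02]
  · by_cases h2 : v i = 2
    · have h20 : ¬ ((2 : ZMod 4) = 0) := by decide
      simp [h2, h20]
    · simp [h0, h2]

open Classical in
/-- symmetrized weight enumerator -/
noncomputable def swe {n : ℕ} (C : Submodule (ZMod 4) (Fin n → ZMod 4)) (a b c : ℂ) : ℂ :=
  ∑ v ∈ Finset.univ.filter (fun v => v ∈ C), ∏ i, sw a b c (v i)

/-- the additive character of `ZMod 4` -/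
noncomputable def chi (s : ZMod 4) : ℂ := Complex.I ^ s.val

lemma chi_add (s t : ZMod 4) : chi (s + t) = chi s * chi t := by
  unfold chi
  rw [ZMod.val_add, ← pow_add]
  conv_rhs => rw [← Nat.div_add_mod (s.val + t.val) 4, pow_add, pow_mul, Complex.I_pow_four, one_pow, one_mul]

lemma chi_zero : chi 0 = 1 := by simp [chi]

lemma chi_ne_one (s : ZMod 4) (hs : s ≠ 0) : chi s ≠ 1 := by
  have h : s = 1 ∨ s = 2 ∨ s = 3 := by revert s; decide
  have v2 : (2 : ZMod 4).val = 2 := rfl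
  have v3 : (3 : ZMod 4).val = 3 := rfl
  have v1 : (1 : ZMod 4).val = 1 := rfl
  rcases h with rfl | rfl | rfl
  · simp [chi, v1, Complex.ext_iff]
  · simp only [chi, v2, Complex.I_sq]; norm_num
  · simp [chi, v3, Complex.I_pow_three, Complex.ext_iff]

lemma chi_sum {ι : Type*} (s : Finset ι) (f : ι → ZMod 4) :
    chi (∑ i ∈ s, f i) = ∏ i ∈ s, chi (f i) := by
  classical
  induction s using Finset.induction_on with
  | empty => simp [chi_zero]
  | insert a s ha ih => rw [Finset.sum_insert ha, Finset.prod_insert ha, chi_add, ih]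

lemma sw_hat (a b c : ℂ) (s : ZMod 4) :
    ∑ t, chi (s * t) * sw a b c t = sw (a + 2 * b + c) (a - c) (a - 2 * b + c) s := by
  have e : ∀ f : ZMod 4 → ℂ, ∑ t, f t = f 0 + f 1 + f 2 + f 3 := by
    intro f; exact Fin.sum_univ_four f
  rw [e]
  have v2 : (2 : ZMod 4).val = 2 := rfl
  have v3 : (3 : ZMod 4).val = 3 := rfl
  have v1 : (1 : ZMod 4).val = 1 := rfl
  have c1 : chi 1 = Complex.I := by simp [chi, v1]
  have c2 : chi 2 = -1 := by simp [chi, v2]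
  have c3 : chi 3 = -Complex.I := by simp [chi, v3, Complex.I_pow_three]
  have s0 : ∀ a b c : ℂ, sw a b c 0 = a := fun a b c => rfl
  have s1 : ∀ a b c : ℂ, sw a b c 1 = b := fun a b c => by
    rw [sw, if_neg (by decide), if_neg (by decide)]
  have s2 : ∀ a b c : ℂ, sw a b c 2 = c := fun a b c => by
    rw [sw, if_neg (by decide), if_pos rfl]
  have s3 : ∀ a b c : ℂ, sw a b c 3 = b := fun a b c => by
    rw [sw, if_neg (by decide), if_neg (by decide)]
  have h : s = 0 ∨ s = 1 ∨ s = 2 ∨ s = 3 := by revert s; decide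
  have m22 : (2 * 2 : ZMod 4) = 0 := by decide
  have m23 : (2 * 3 : ZMod 4) = 2 := by decide
  have m32 : (3 * 2 : ZMod 4) = 2 := by decide
  have m33 : (3 * 3 : ZMod 4) = 1 := by decide
  rcases h with rfl | rfl | rfl | rfl <;>
    simp only [s0, s1, s2, s3, m22, m23, m32, m33, mul_zero, zero_mul, mul_one, one_mul, chi_zero, c1, c2, c3] <;> ring

open Classical in
lemma char_sum {n : ℕ} (C : Submodule (ZMod 4) (Fin n → ZMod 4)) (u : Fin n → ZMod 4) :
    ∑ v ∈ Finset.univ.filter (fun v => v ∈ C), chi (z4Inner v u) =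
      if u ∈ z4Dual (C : Set (Fin n → ZMod 4)) then
        ((Finset.univ.filter (fun v => v ∈ C)).card : ℂ) else 0 := by
  have comm : ∀ x y : Fin n → ZMod 4, z4Inner x y = z4Inner y x := fun x y => by
    simp [z4Inner, mul_comm]
  split_ifs with h
  · rw [Finset.sum_congr rfl (g := fun _ => 1)]
    · simp
    · intro v hv
      rw [comm, h v (by simpa using hv), chi_zero]
  · simp only [z4Dual, Set.mem_ofPred_eq, not_forall] at h
    obtain ⟨c, hc, hne⟩ := h
    have hc' : c ∈ C := hc
    have key : ∑ v ∈ Finset.univ.filter (fun v => v ∈ C), chi (z4Inner v u) =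
        chi (z4Inner c u) * ∑ v ∈ Finset.univ.filter (fun v => v ∈ C), chi (z4Inner v u) := by
      rw [Finset.mul_sum]
      symm
      refine Finset.sum_bij (fun v _ => c + v) ?_ ?_ ?_ ?_
      · intro v hv
        simp only [Finset.mem_filter, Finset.mem_univ, true_and] at hv ⊢
        exact C.add_mem hc' hv
      · intro v _ w _ hvw
        exact add_left_cancel hvw
      · intro w hw
        simp only [Finset.mem_filter, Finset.mem_univ, true_and] at hw
        exact ⟨w - c, by simpa using C.sub_mem hw hc', by abel⟩
      · intro v _
        rw [← chi_add]
        congr 1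
        simp [z4Inner, add_mul, Finset.sum_add_distrib]
    have hn1 : chi (z4Inner c u) ≠ 1 := chi_ne_one _ (by rw [comm]; exact hne)
    have : (chi (z4Inner c u) - 1) *
        ∑ v ∈ Finset.univ.filter (fun v => v ∈ C), chi (z4Inner v u) = 0 := by
      rw [sub_mul, one_mul, ← key, sub_self]
    exact (mul_eq_zero.mp this).resolve_left (sub_ne_zero.mpr hn1)

open Classical in
lemma macw_card {n : ℕ} (C : Submodule (ZMod 4) (Fin n → ZMod 4))
    (hC : IsSelfDualZ4 (C : Set (Fin n → ZMod 4))) (a b c : ℂ) :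
    swe C (a + 2 * b + c) (a - c) (a - 2 * b + c) =
      ((Finset.univ.filter (fun v => v ∈ C)).card : ℂ) * swe C a b c := by
  unfold swe
  have h1 : ∀ v : Fin n → ZMod 4, ∏ i, sw (a + 2 * b + c) (a - c) (a - 2 * b + c) (v i) =
      ∑ u : Fin n → ZMod 4, chi (z4Inner v u) * ∏ i, sw a b c (u i) := by
    intro v
    simp_rw [← sw_hat a b c]
    rw [Finset.prod_univ_sum, Fintype.piFinset_univ]
    refine Finset.sum_congr rfl fun u _ => ?_
    rw [Finset.prod_mul_distrib, z4Inner, chi_sum]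
  simp_rw [h1]
  rw [Finset.sum_comm]
  simp_rw [← Finset.sum_mul, char_sum]
  rw [Finset.mul_sum, Finset.sum_filter]
  refine Finset.sum_congr rfl fun u _ => ?_
  rw [← hC]
  simp only [SetLike.mem_coe]
  split_ifs <;> simp

lemma swe_hom {n : ℕ} (C : Submodule (ZMod 4) (Fin n → ZMod 4)) (k a b c : ℂ) :
    swe C (k * a) (k * b) (k * c) = k ^ n * swe C a b c := by
  unfold swe
  rw [Finset.mul_sum]
  refine Finset.sum_congr rfl fun v _ => ?_
  rw [prod_sw, prod_sw]
  have hk : k ^ n = k ^ cnt0 v * k ^ cnt1 v * k ^ cnt2 v := by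
    rw [← pow_add, ← pow_add, cnt_sum]
  rw [hk]
  ring

lemma swe_delta {n : ℕ} (C : Submodule (ZMod 4) (Fin n → ZMod 4)) :
    swe C 1 0 0 = 1 := by
  classical
  unfold swe
  rw [Finset.sum_eq_single 0]
  · simp [sw]
  · intro v _ hv
    obtain ⟨i, hi⟩ : ∃ i, v i ≠ 0 := by
      by_contra h; push Not at h; exact hv (funext h)
    exact Finset.prod_eq_zero (Finset.mem_univ i) (by simp [sw, hi])
  · intro h; simp at h

open Classical in
lemma card_eq {n : ℕ} (C : Submodule (ZMod 4) (Fin n → ZMod 4))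
    (hC : IsSelfDualZ4 (C : Set (Fin n → ZMod 4))) :
    ((Finset.univ.filter (fun v => v ∈ C)).card : ℂ) = 2 ^ n := by
  have h1 := macw_card C hC 1 0 0
  have h2 := macw_card C hC 1 1 1
  have h3 := swe_hom C 4 1 0 0
  rw [swe_delta] at h1 h3
  norm_num at h1 h2 h3
  rw [h1, h3] at h2
  set N := (Finset.univ.filter (fun v => v ∈ C)).card
  have : (4 : ℕ) ^ n = N * N := by exact_mod_cast h2
  have h4 : (2 ^ n) * (2 ^ n) = N * N := by rw [← this, ← mul_pow]; norm_num
  have := Nat.mul_self_inj.mp h4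
  exact_mod_cast this.symm

/-- swe in the monomial coordinates -/
noncomputable def tw {n : ℕ} (C : Submodule (ZMod 4) (Fin n → ZMod 4)) (x y z : ℂ) : ℂ :=
  swe C (x + y) z (x - y)

lemma tw_swap {n : ℕ} (C : Submodule (ZMod 4) (Fin n → ZMod 4))
    (hC : IsSelfDualZ4 (C : Set (Fin n → ZMod 4))) (x y z : ℂ) :
    tw C x z y = tw C x y z := by
  have h1 := macw_card C hC (x + y) z (x - y)
  rw [card_eq C hC] at h1
  have h2 := swe_hom C 2 (x + z) y (x - z)
  have h3 : swe C (x + y + 2 * z + (x - y)) (x + y - (x - y)) (x + y - 2 * z + (x - y)) =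
    swe C (2 * (x + z)) (2 * y) (2 * (x - z)) := by congr 1 <;> ring
  rw [h3, h2] at h1
  exact mul_left_cancel₀ (pow_ne_zero _ two_ne_zero) h1

lemma tw_hom {n : ℕ} (C : Submodule (ZMod 4) (Fin n → ZMod 4)) (k x y z : ℂ) :
    tw C (k * x) (k * y) (k * z) = k ^ n * tw C x y z := by
  unfold tw
  rw [← swe_hom]; congr 1 <;> ring

lemma tw_rot {n : ℕ} (C : Submodule (ZMod 4) (Fin n → ZMod 4))
    (hC : IsTypeIIZ4 (C : Set (Fin n → ZMod 4))) (ζ : ℂ) (hζ : ζ ^ 4 = -1) (x y z : ℂ) :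
    tw C y x (ζ * z) = tw C x y z := by
  unfold tw swe
  refine Finset.sum_congr rfl fun v hv => ?_
  rw [prod_sw, prod_sw]
  obtain ⟨k, hk⟩ := hC.2 v (by simpa using hv)
  rw [euclWt_eq] at hk
  have h8 : ζ ^ (cnt1 v + 4 * cnt2 v) = 1 := by
    rw [hk, pow_mul, show (8 : ℕ) = 4 * 2 from rfl, pow_mul, hζ]; simp
  rw [show y - x = ζ ^ 4 * (x - y) by rw [hζ]; ring, mul_pow, mul_pow, ← pow_mul]
  rw [pow_add] at h8
  rw [add_comm y x]
  linear_combination (x + y) ^ cnt0 v * z ^ cnt1 v * (x - y) ^ cnt2 v * h8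

lemma exists_zeta : ∃ ζ : ℂ, ζ ^ 4 = -1 := IsAlgClosed.exists_pow_nat_eq _ (by norm_num)

lemma four_dvd_cnt1 {n : ℕ} (C : Submodule (ZMod 4) (Fin n → ZMod 4))
    (hC : IsTypeIIZ4 (C : Set (Fin n → ZMod 4))) (v : Fin n → ZMod 4) (hv : v ∈ C) :
    4 * (cnt1 v / 4) = cnt1 v := by
  have := hC.2 v hv
  rw [euclWt_eq] at this
  omega

lemma tw_iz {n : ℕ} (C : Submodule (ZMod 4) (Fin n → ZMod 4))
    (hC : IsTypeIIZ4 (C : Set (Fin n → ZMod 4))) (x y z : ℂ) :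
    tw C x y (Complex.I * z) = tw C x y z := by
  unfold tw swe
  refine Finset.sum_congr rfl fun v hv => ?_
  rw [prod_sw, prod_sw, mul_pow, ← four_dvd_cnt1 C hC v (by simpa using hv),
    pow_mul Complex.I, Complex.I_pow_four, one_pow, one_mul]

lemma tw_ix {n : ℕ} (C : Submodule (ZMod 4) (Fin n → ZMod 4))
    (hC : IsTypeIIZ4 (C : Set (Fin n → ZMod 4))) (x y z : ℂ) :
    tw C (Complex.I * x) y z = tw C x y z := by
  obtain ⟨ζ, hζ⟩ := exists_zeta
  rw [← tw_rot C hC ζ hζ, ← tw_swap C hC.1, tw_iz C hC, tw_swap C hC.1, tw_rot C hC ζ hζ]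

open Polynomial in
open Classical in
/-- restriction of swe to the quartic curve -/
noncomputable def rpoly {n : ℕ} (C : Submodule (ZMod 4) (Fin n → ZMod 4)) : Polynomial ℂ :=
  ∑ v ∈ Finset.univ.filter (fun v => v ∈ C),
    (X + 1) ^ cnt0 v * (X ^ 4 - 1) ^ (cnt1 v / 4) * (X - 1) ^ cnt2 v

lemma rpoly_eval {n : ℕ} (C : Submodule (ZMod 4) (Fin n → ZMod 4))
    (hC : IsTypeIIZ4 (C : Set (Fin n → ZMod 4))) (x z : ℂ) (hz : z ^ 4 = x ^ 4 - 1) :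
    (rpoly C).eval x = tw C x 1 z := by
  unfold rpoly tw swe
  rw [Polynomial.eval_finsetSum]
  refine Finset.sum_congr rfl fun v hv => ?_
  rw [prod_sw]
  conv_rhs => rw [← four_dvd_cnt1 C hC v (by simpa using hv), pow_mul, hz]
  simp

lemma rpoly_deg {n : ℕ} (C : Submodule (ZMod 4) (Fin n → ZMod 4))
    (hC : IsTypeIIZ4 (C : Set (Fin n → ZMod 4))) : (rpoly C).natDegree ≤ n := by
  unfold rpoly
  refine Polynomial.natDegree_sum_le_of_forall_le _ _ fun v hv => ?_
  have h4 := four_dvd_cnt1 C hC v (by simpa using hv)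
  have hs := cnt_sum v
  have : cnt0 v * 1 + (cnt1 v / 4) * 4 + cnt2 v * 1 ≤ n := by omega
  refine le_trans ?_ this
  compute_degree
  omega

lemma exists_fourth (x : ℂ) : ∃ z : ℂ, z ^ 4 = x := IsAlgClosed.exists_pow_nat_eq _ (by norm_num)

lemma rpoly_I {n : ℕ} (C : Submodule (ZMod 4) (Fin n → ZMod 4))
    (hC : IsTypeIIZ4 (C : Set (Fin n → ZMod 4))) (x : ℂ) :
    (rpoly C).eval (Complex.I * x) = (rpoly C).eval x := by
  obtain ⟨z, hz⟩ := exists_fourth (x ^ 4 - 1)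
  rw [rpoly_eval C hC x z hz, rpoly_eval C hC (Complex.I * x) z, tw_ix C hC]
  rw [hz, mul_pow, Complex.I_pow_four, one_mul]

lemma rpoly_coeff {n : ℕ} (C : Submodule (ZMod 4) (Fin n → ZMod 4))
    (hC : IsTypeIIZ4 (C : Set (Fin n → ZMod 4))) (k : ℕ) (hk : ¬ 4 ∣ k) :
    (rpoly C).coeff k = 0 := by
  have h : (rpoly C).comp (Polynomial.C Complex.I * Polynomial.X) = rpoly C := by
    apply Polynomial.funext
    intro x
    simp [rpoly_I C hC]
  have h2 := congrArg (fun p => Polynomial.coeff p k) h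
  simp only [Polynomial.comp_C_mul_X_coeff] at h2
  have h3 : Complex.I ^ k ≠ 1 := by
    rw [← Nat.div_add_mod k 4, pow_add, pow_mul, Complex.I_pow_four, one_pow, one_mul]
    have : k % 4 = 1 ∨ k % 4 = 2 ∨ k % 4 = 3 := by omega
    rcases this with h | h | h <;> rw [h] <;>
      simp [Complex.I_pow_three, Complex.ext_iff] <;> norm_num
  have : (rpoly C).coeff k * (Complex.I ^ k - 1) = 0 := by linear_combination h2
  exact (mul_eq_zero.mp this).resolve_right (sub_ne_zero.mpr h3)

/-- the polynomial in the fourth powers -/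
lemma rpoly_sum {N : ℕ} (C : Submodule (ZMod 4) (Fin (4 * N) → ZMod 4))
    (hC : IsTypeIIZ4 (C : Set (Fin (4 * N) → ZMod 4))) (x : ℂ) :
    (rpoly C).eval x = ∑ j ∈ Finset.range (N + 1), (rpoly C).coeff (4 * j) * x ^ (4 * j) := by
  rw [Polynomial.eval_eq_sum_range' (n := 4 * (N + 1)) (by have := rpoly_deg C hC; omega)]
  symm
  rw [← Finset.sum_image (s := Finset.range (N + 1)) (g := fun j => 4 * j)
    (f := fun k => (rpoly C).coeff k * x ^ k) (by intro a _ b _ h; simpa using h)]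
  refine Finset.sum_subset ?_ ?_
  · intro k hk
    simp only [Finset.mem_image, Finset.mem_range] at hk ⊢
    omega
  · intro k hk hk2
    rw [rpoly_coeff C hC k, zero_mul]
    rintro ⟨j, rfl⟩
    apply hk2
    simp only [Finset.mem_image, Finset.mem_range] at hk ⊢
    exact ⟨j, by omega, rfl⟩

lemma q_sym1 {N : ℕ} (C : Submodule (ZMod 4) (Fin (4 * N) → ZMod 4))
    (hC : IsTypeIIZ4 (C : Set (Fin (4 * N) → ZMod 4))) (X : ℂ) (hX : X ≠ 1) :
    ∑ j ∈ Finset.range (N + 1), (rpoly C).coeff (4 * j) * X ^ j =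
    ∑ j ∈ Finset.range (N + 1), (rpoly C).coeff (4 * j) * (X ^ j * (X - 1) ^ (N - j)) := by
  obtain ⟨x, rfl⟩ := exists_fourth X
  obtain ⟨z, hz⟩ := exists_fourth (x ^ 4 - 1)
  have hz0 : z ≠ 0 := by
    rintro rfl
    apply hX; linear_combination -hz
  have h1 := rpoly_eval C hC x z hz
  have h2 := rpoly_eval C hC (x / z) (1 / z) (by rw [div_pow, div_pow]; field_simp; linear_combination hz)
  have h3 := tw_hom C z (x / z) 1 (1 / z)
  rw [mul_div_cancel₀ _ hz0, mul_div_cancel₀ _ hz0, mul_one, tw_swap C hC.1, ← h1, ← h2,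
    rpoly_sum C hC, rpoly_sum C hC, Finset.mul_sum] at h3
  simp_rw [pow_mul] at h3 ⊢
  rw [h3]
  refine Finset.sum_congr rfl fun j hj => ?_
  rw [← hz, div_pow, div_pow]
  have hj : j ≤ N := by simpa [Nat.lt_succ_iff] using hj
  have : (z ^ 4) ^ j ≠ 0 := pow_ne_zero _ (pow_ne_zero _ hz0)
  have hp : (z ^ 4) ^ N = (z ^ 4) ^ (N - j) * (z ^ 4) ^ j := by
    rw [← pow_add, Nat.sub_add_cancel hj]
  rw [hp]
  field_simp

lemma q_sym2 {N : ℕ} (C : Submodule (ZMod 4) (Fin (4 * N) → ZMod 4))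
    (hC : IsTypeIIZ4 (C : Set (Fin (4 * N) → ZMod 4))) (X : ℂ) (hX : X ≠ 0) :
    ∑ j ∈ Finset.range (N + 1), (rpoly C).coeff (4 * j) * X ^ j =
    ∑ j ∈ Finset.range (N + 1), (rpoly C).coeff (4 * j) * X ^ (N - j) := by
  obtain ⟨x, rfl⟩ := exists_fourth X
  obtain ⟨z, hz⟩ := exists_fourth (x ^ 4 - 1)
  obtain ⟨ζ, hζ⟩ := exists_zeta
  have hx0 : x ≠ 0 := by
    rintro rfl
    simp at hX
  have h1 := rpoly_eval C hC x z hz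
  have h2 := rpoly_eval C hC (1 / x) (ζ * z / x)
    (by rw [div_pow, div_pow, mul_pow, hζ, hz]; field_simp; ring)
  have h3 := tw_hom C x (1 / x) 1 (ζ * z / x)
  rw [mul_div_cancel₀ _ hx0, mul_div_cancel₀ _ hx0, mul_one, tw_rot C hC ζ hζ, ← h1, ← h2,
    rpoly_sum C hC, rpoly_sum C hC, Finset.mul_sum] at h3
  simp_rw [pow_mul] at h3 ⊢
  rw [h3]
  refine Finset.sum_congr rfl fun j hj => ?_
  have hj : j ≤ N := by simpa [Nat.lt_succ_iff] using hj
  rw [div_pow, div_pow, one_pow, one_pow]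
  have : (x ^ 4) ^ j ≠ 0 := pow_ne_zero _ (pow_ne_zero _ hx0)
  have hp : (x ^ 4) ^ N = (x ^ 4) ^ (N - j) * (x ^ 4) ^ j := by
    rw [← pow_add, Nat.sub_add_cancel hj]
  rw [hp]
  field_simp

open Polynomial in
open Classical in
lemma q_trunc {N : ℕ} (C : Submodule (ZMod 4) (Fin (4 * N) → ZMod 4))
    (hC : IsTypeIIZ4 (C : Set (Fin (4 * N) → ZMod 4)))
    (hmin : ∀ v ∈ C, v ≠ 0 → 32 ≤ euclWt v) (k : ℕ) (hk : k < 8) :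
    ∑ j ∈ Finset.range (N + 1), (rpoly C).coeff (4 * j) *
      ((1 + X : Polynomial ℂ) ^ (4 * j) * (1 - X) ^ (4 * (N - j))).coeff k =
      if k = 0 then 2 ^ (4 * N) else 0 := by
  have key : ∑ j ∈ Finset.range (N + 1), Polynomial.C ((rpoly C).coeff (4 * j)) *
      ((1 + X : Polynomial ℂ) ^ (4 * j) * (1 - X) ^ (4 * (N - j))) =
      ∑ v ∈ Finset.univ.filter (fun v => v ∈ C),
        X ^ (cnt2 v + cnt1 v / 4) * (Polynomial.C (2 ^ (cnt0 v + cnt2 v + 3 * (cnt1 v / 4))) * (1 + X ^ 2) ^ (cnt1 v / 4)) := by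
    apply Polynomial.eq_of_infinite_eval_eq
    refine Set.Infinite.mono (s := {1}ᶜ) ?_ (Set.finite_singleton (1 : ℂ)).infinite_compl
    intro c hc
    have hc1 : (1 - c) ≠ 0 := by
      intro h; apply hc
      have : c = 1 := by linear_combination -h
      simp [this]
    simp only [Set.mem_ofPred_eq, eval_finsetSum, eval_mul, eval_C, eval_pow, eval_add, eval_sub, eval_one, eval_X]
    have h1 := rpoly_sum C hC ((1 + c) / (1 - c))
    have h2 : (1 - c) ^ (4 * N) * (rpoly C).eval ((1 + c) / (1 - c)) =
        ∑ j ∈ Finset.range (N + 1), (rpoly C).coeff (4 * j) * ((1 + c) ^ (4 * j) * (1 - c) ^ (4 * (N - j))) := by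
      rw [h1, Finset.mul_sum]
      refine Finset.sum_congr rfl fun j hj => ?_
      have hj : j ≤ N := by simpa [Nat.lt_succ_iff] using hj
      have e : 4 * N = 4 * (N - j) + 4 * j := by omega
      have hp : (1 - c) ^ (4 * N) = (1 - c) ^ (4 * (N - j)) * (1 - c) ^ (4 * j) := by
        rw [← pow_add, ← e]
      rw [hp, div_pow]
      have : (1 - c) ^ (4 * j) ≠ 0 := pow_ne_zero _ hc1
      field_simp
    rw [← h2, rpoly, eval_finsetSum, Finset.mul_sum]
    refine Finset.sum_congr rfl fun v hv => ?_
    have h4 := four_dvd_cnt1 C hC v (by simpa using hv)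
    have hs := cnt_sum v
    have e : 4 * N = cnt0 v + 4 * (cnt1 v / 4) + cnt2 v := by omega
    have hp : (1 - c) ^ (4 * N) =
        (1 - c) ^ cnt0 v * (1 - c) ^ (4 * (cnt1 v / 4)) * (1 - c) ^ cnt2 v := by
      rw [← pow_add, ← pow_add, ← e]
    rw [hp]
    simp only [eval_mul, eval_pow, eval_add, eval_sub, eval_one, eval_X]
    have a1 : (1 + c) / (1 - c) + 1 = 2 / (1 - c) := by field_simp; ring
    have a2 : (1 + c) / (1 - c) - 1 = 2 * c / (1 - c) := by field_simp; ring
    have a3 : ((1 + c) / (1 - c)) ^ 4 - 1 = 2 ^ 3 * c * (1 + c ^ 2) / (1 - c) ^ 4 := by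
      field_simp; ring
    rw [a1, a2, a3]
    generalize cnt1 v / 4 = m
    simp only [div_pow, mul_pow, pow_add, ← pow_mul]
    have b1 := pow_ne_zero (cnt0 v) hc1
    have b2 := pow_ne_zero (cnt2 v) hc1
    have b3 := pow_ne_zero (4 * m) hc1
    field_simp
  have h5 := congrArg (fun p => Polynomial.coeff p k) key
  simp only [finsetSum_coeff, coeff_C_mul] at h5
  rw [h5, Finset.sum_eq_single 0]
  · have c0 : cnt0 (0 : Fin (4 * N) → ZMod 4) = 4 * N := by simp [cnt0]
    have c1 : cnt1 (0 : Fin (4 * N) → ZMod 4) = 0 := by simp [cnt1]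
    have c2 : cnt2 (0 : Fin (4 * N) → ZMod 4) = 0 := by
      have := cnt_sum (0 : Fin (4 * N) → ZMod 4)
      omega
    rw [c0, c1, c2]
    simp only [Nat.zero_div, add_zero, mul_zero, pow_zero, one_mul, mul_one, coeff_C]
  · intro v hv hv0
    have := hmin v (by simpa using hv) hv0
    rw [euclWt_eq] at this
    rw [coeff_X_pow_mul', if_neg (by omega)]
  · intro h; simp at h

/-- coefficients of `(1 + X) ^ a * (1 - X) ^ b` -/
def kr (a b k : ℕ) : ℤ :=
  ∑ i ∈ Finset.range (k + 1), (a.choose i : ℤ) * ((-1) ^ (k - i) * (b.choose (k - i) : ℤ))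

/-- the same, in a form that evaluates quickly -/
def krf (a b k : ℕ) : ℤ :=
  ∑ i ∈ Finset.range (k + 1), ((a.descFactorial i / i.factorial : ℕ) : ℤ) *
    ((-1) ^ (k - i) * ((b.descFactorial (k - i) / (k - i).factorial : ℕ) : ℤ))

lemma kr_eq (a b k : ℕ) : kr a b k = krf a b k := by
  simp only [kr, krf, Nat.choose_eq_descFactorial_div_factorial]

open Polynomial in
lemma coeff_kr (a b k : ℕ) :
    ((1 + X : Polynomial ℂ) ^ a * (1 - X) ^ b).coeff k = (kr a b k : ℂ) := by
  have h : (1 - X : Polynomial ℂ) ^ b = ((1 + X : Polynomial ℂ) ^ b).comp (C (-1) * X) := by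
    simp [sub_eq_add_neg]
  rw [coeff_mul, Finset.Nat.sum_antidiagonal_eq_sum_range_succ_mk, h]
  simp only [comp_C_mul_X_coeff, coeff_one_add_X_pow, kr]
  push_cast
  refine Finset.sum_congr rfl fun i _ => ?_
  ring

set_option maxHeartbeats 4000000 in
lemma contra12 (q : ℕ → ℂ)
    (h1 : ∀ X : ℂ, X ≠ 1 → ∑ j ∈ Finset.range (12 + 1), q j * X ^ j =
      ∑ j ∈ Finset.range (12 + 1), q j * (X ^ j * (X - 1) ^ (12 - j)))
    (h2 : ∀ X : ℂ, X ≠ 0 → ∑ j ∈ Finset.range (12 + 1), q j * X ^ j =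
      ∑ j ∈ Finset.range (12 + 1), q j * X ^ (12 - j))
    (ht : ∀ k : ℕ, k < 8 → ∑ j ∈ Finset.range (12 + 1), q j * (kr (4 * j) (4 * (12 - j)) k : ℂ) =
      if k = 0 then 2 ^ (4 * 12) else 0) : False := by
  have k0_0 : kr (4 * 0) (4 * (12 - 0)) 0 = 1 := by rw [kr_eq]; decide +kernel
  have k0_1 : kr (4 * 1) (4 * (12 - 1)) 0 = 1 := by rw [kr_eq]; decide +kernel
  have k0_2 : kr (4 * 2) (4 * (12 - 2)) 0 = 1 := by rw [kr_eq]; decide +kernel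
  have k0_3 : kr (4 * 3) (4 * (12 - 3)) 0 = 1 := by rw [kr_eq]; decide +kernel
  have k0_4 : kr (4 * 4) (4 * (12 - 4)) 0 = 1 := by rw [kr_eq]; decide +kernel
  have k0_5 : kr (4 * 5) (4 * (12 - 5)) 0 = 1 := by rw [kr_eq]; decide +kernel
  have k0_6 : kr (4 * 6) (4 * (12 - 6)) 0 = 1 := by rw [kr_eq]; decide +kernel
  have k0_7 : kr (4 * 7) (4 * (12 - 7)) 0 = 1 := by rw [kr_eq]; decide +kernel
  have k0_8 : kr (4 * 8) (4 * (12 - 8)) 0 = 1 := by rw [kr_eq]; decide +kernel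
  have k0_9 : kr (4 * 9) (4 * (12 - 9)) 0 = 1 := by rw [kr_eq]; decide +kernel
  have k0_10 : kr (4 * 10) (4 * (12 - 10)) 0 = 1 := by rw [kr_eq]; decide +kernel
  have k0_11 : kr (4 * 11) (4 * (12 - 11)) 0 = 1 := by rw [kr_eq]; decide +kernel
  have k0_12 : kr (4 * 12) (4 * (12 - 12)) 0 = 1 := by rw [kr_eq]; decide +kernel
  have t0 := ht 0 (by norm_num)
  simp only [Finset.sum_range_succ, Finset.sum_range_zero, k0_0, k0_1, k0_2, k0_3, k0_4, k0_5, k0_6, k0_7, k0_8, k0_9, k0_10, k0_11, k0_12] at t0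
  norm_num at t0
  have k2_0 : kr (4 * 0) (4 * (12 - 0)) 2 = 1128 := by rw [kr_eq]; decide +kernel
  have k2_1 : kr (4 * 1) (4 * (12 - 1)) 2 = 776 := by rw [kr_eq]; decide +kernel
  have k2_2 : kr (4 * 2) (4 * (12 - 2)) 2 = 488 := by rw [kr_eq]; decide +kernel
  have k2_3 : kr (4 * 3) (4 * (12 - 3)) 2 = 264 := by rw [kr_eq]; decide +kernel
  have k2_4 : kr (4 * 4) (4 * (12 - 4)) 2 = 104 := by rw [kr_eq]; decide +kernel
  have k2_5 : kr (4 * 5) (4 * (12 - 5)) 2 = 8 := by rw [kr_eq]; decide +kernel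
  have k2_6 : kr (4 * 6) (4 * (12 - 6)) 2 = -24 := by rw [kr_eq]; decide +kernel
  have k2_7 : kr (4 * 7) (4 * (12 - 7)) 2 = 8 := by rw [kr_eq]; decide +kernel
  have k2_8 : kr (4 * 8) (4 * (12 - 8)) 2 = 104 := by rw [kr_eq]; decide +kernel
  have k2_9 : kr (4 * 9) (4 * (12 - 9)) 2 = 264 := by rw [kr_eq]; decide +kernel
  have k2_10 : kr (4 * 10) (4 * (12 - 10)) 2 = 488 := by rw [kr_eq]; decide +kernel
  have k2_11 : kr (4 * 11) (4 * (12 - 11)) 2 = 776 := by rw [kr_eq]; decide +kernel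
  have k2_12 : kr (4 * 12) (4 * (12 - 12)) 2 = 1128 := by rw [kr_eq]; decide +kernel
  have t2 := ht 2 (by norm_num)
  simp only [Finset.sum_range_succ, Finset.sum_range_zero, k2_0, k2_1, k2_2, k2_3, k2_4, k2_5, k2_6, k2_7, k2_8, k2_9, k2_10, k2_11, k2_12] at t2
  norm_num at t2
  have k4_0 : kr (4 * 0) (4 * (12 - 0)) 4 = 194580 := by rw [kr_eq]; decide +kernel
  have k4_1 : kr (4 * 1) (4 * (12 - 1)) 4 = 88276 := by rw [kr_eq]; decide +kernel
  have k4_2 : kr (4 * 2) (4 * (12 - 2)) 4 = 32020 := by rw [kr_eq]; decide +kernel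
  have k4_3 : kr (4 * 3) (4 * (12 - 3)) 4 = 7380 := by rw [kr_eq]; decide +kernel
  have k4_4 : kr (4 * 4) (4 * (12 - 4)) 4 = 20 := by rw [kr_eq]; decide +kernel
  have k4_5 : kr (4 * 5) (4 * (12 - 5)) 4 = -300 := by rw [kr_eq]; decide +kernel
  have k4_6 : kr (4 * 6) (4 * (12 - 6)) 4 = 276 := by rw [kr_eq]; decide +kernel
  have k4_7 : kr (4 * 7) (4 * (12 - 7)) 4 = -300 := by rw [kr_eq]; decide +kernel
  have k4_8 : kr (4 * 8) (4 * (12 - 8)) 4 = 20 := by rw [kr_eq]; decide +kernel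
  have k4_9 : kr (4 * 9) (4 * (12 - 9)) 4 = 7380 := by rw [kr_eq]; decide +kernel
  have k4_10 : kr (4 * 10) (4 * (12 - 10)) 4 = 32020 := by rw [kr_eq]; decide +kernel
  have k4_11 : kr (4 * 11) (4 * (12 - 11)) 4 = 88276 := by rw [kr_eq]; decide +kernel
  have k4_12 : kr (4 * 12) (4 * (12 - 12)) 4 = 194580 := by rw [kr_eq]; decide +kernel
  have t4 := ht 4 (by norm_num)
  simp only [Finset.sum_range_succ, Finset.sum_range_zero, k4_0, k4_1, k4_2, k4_3, k4_4, k4_5, k4_6, k4_7, k4_8, k4_9, k4_10, k4_11, k4_12] at t4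
  norm_num at t4
  have k6_0 : kr (4 * 0) (4 * (12 - 0)) 6 = 12271512 := by rw [kr_eq]; decide +kernel
  have k6_1 : kr (4 * 1) (4 * (12 - 1)) 6 = 3477496 := by rw [kr_eq]; decide +kernel
  have k6_2 : kr (4 * 2) (4 * (12 - 2)) 6 = 632344 := by rw [kr_eq]; decide +kernel
  have k6_3 : kr (4 * 3) (4 * (12 - 3)) 6 = 25080 := by rw [kr_eq]; decide +kernel
  have k6_4 : kr (4 * 4) (4 * (12 - 4)) 6 = -7272 := by rw [kr_eq]; decide +kernel
  have k6_5 : kr (4 * 5) (4 * (12 - 5)) 6 = 2808 := by rw [kr_eq]; decide +kernel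
  have k6_6 : kr (4 * 6) (4 * (12 - 6)) 6 = -2024 := by rw [kr_eq]; decide +kernel
  have k6_7 : kr (4 * 7) (4 * (12 - 7)) 6 = 2808 := by rw [kr_eq]; decide +kernel
  have k6_8 : kr (4 * 8) (4 * (12 - 8)) 6 = -7272 := by rw [kr_eq]; decide +kernel
  have k6_9 : kr (4 * 9) (4 * (12 - 9)) 6 = 25080 := by rw [kr_eq]; decide +kernel
  have k6_10 : kr (4 * 10) (4 * (12 - 10)) 6 = 632344 := by rw [kr_eq]; decide +kernel
  have k6_11 : kr (4 * 11) (4 * (12 - 11)) 6 = 3477496 := by rw [kr_eq]; decide +kernel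
  have k6_12 : kr (4 * 12) (4 * (12 - 12)) 6 = 12271512 := by rw [kr_eq]; decide +kernel
  have t6 := ht 6 (by norm_num)
  simp only [Finset.sum_range_succ, Finset.sum_range_zero, k6_0, k6_1, k6_2, k6_3, k6_4, k6_5, k6_6, k6_7, k6_8, k6_9, k6_10, k6_11, k6_12] at t6
  norm_num at t6
  have e3 := h2 (2) (by norm_num)
  simp only [Finset.sum_range_succ, Finset.sum_range_zero] at e3
  norm_num at e3
  have e4 := h2 (3) (by norm_num)
  simp only [Finset.sum_range_succ, Finset.sum_range_zero] at e4
  norm_num at e4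
  have e5 := h2 (-2) (by norm_num)
  simp only [Finset.sum_range_succ, Finset.sum_range_zero] at e5
  norm_num at e5
  have e6 := h2 (4) (by norm_num)
  simp only [Finset.sum_range_succ, Finset.sum_range_zero] at e6
  norm_num at e6
  have e7 := h2 (-3) (by norm_num)
  simp only [Finset.sum_range_succ, Finset.sum_range_zero] at e7
  norm_num at e7
  have e8 := h2 (5) (by norm_num)
  simp only [Finset.sum_range_succ, Finset.sum_range_zero] at e8
  norm_num at e8
  have e9 := h1 (-1) (by norm_num)
  simp only [Finset.sum_range_succ, Finset.sum_range_zero] at e9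
  norm_num at e9
  have e10 := h1 (3) (by norm_num)
  simp only [Finset.sum_range_succ, Finset.sum_range_zero] at e10
  norm_num at e10
  have e11 := h1 (-2) (by norm_num)
  simp only [Finset.sum_range_succ, Finset.sum_range_zero] at e11
  norm_num at e11
  have e12 := h1 (4) (by norm_num)
  simp only [Finset.sum_range_succ, Finset.sum_range_zero] at e12
  norm_num at e12
  have hf : (2 : ℂ) ^ 48 = 0 := by
    linear_combination -(1 : ℂ) * (t0 + (12223 / 818928) * t2 + (-1 / 68244) * t4 + (-1 / 818928) * t6 + (67683328 / 8464388625) * e3 + (544576 / 8464388625) * e4 + (683008 / 8464388625) * e5 + (-4096 / 338575545) * e6 + (-20794 / 8464388625) * e7 + (38 / 67715109) * e8 + (-1795072 / 403066125) * e9 + (2413568 / 8464388625) * e10 + (311296 / 8464388625) * e11 + (-512 / 109927125) * e12)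
  norm_num at hf

set_option maxHeartbeats 4000000 in
lemma contra14 (q : ℕ → ℂ)
    (h1 : ∀ X : ℂ, X ≠ 1 → ∑ j ∈ Finset.range (14 + 1), q j * X ^ j =
      ∑ j ∈ Finset.range (14 + 1), q j * (X ^ j * (X - 1) ^ (14 - j)))
    (h2 : ∀ X : ℂ, X ≠ 0 → ∑ j ∈ Finset.range (14 + 1), q j * X ^ j =
      ∑ j ∈ Finset.range (14 + 1), q j * X ^ (14 - j))
    (ht : ∀ k : ℕ, k < 8 → ∑ j ∈ Finset.range (14 + 1), q j * (kr (4 * j) (4 * (14 - j)) k : ℂ) =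
      if k = 0 then 2 ^ (4 * 14) else 0) : False := by
  have k0_0 : kr (4 * 0) (4 * (14 - 0)) 0 = 1 := by rw [kr_eq]; decide +kernel
  have k0_1 : kr (4 * 1) (4 * (14 - 1)) 0 = 1 := by rw [kr_eq]; decide +kernel
  have k0_2 : kr (4 * 2) (4 * (14 - 2)) 0 = 1 := by rw [kr_eq]; decide +kernel
  have k0_3 : kr (4 * 3) (4 * (14 - 3)) 0 = 1 := by rw [kr_eq]; decide +kernel
  have k0_4 : kr (4 * 4) (4 * (14 - 4)) 0 = 1 := by rw [kr_eq]; decide +kernel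
  have k0_5 : kr (4 * 5) (4 * (14 - 5)) 0 = 1 := by rw [kr_eq]; decide +kernel
  have k0_6 : kr (4 * 6) (4 * (14 - 6)) 0 = 1 := by rw [kr_eq]; decide +kernel
  have k0_7 : kr (4 * 7) (4 * (14 - 7)) 0 = 1 := by rw [kr_eq]; decide +kernel
  have k0_8 : kr (4 * 8) (4 * (14 - 8)) 0 = 1 := by rw [kr_eq]; decide +kernel
  have k0_9 : kr (4 * 9) (4 * (14 - 9)) 0 = 1 := by rw [kr_eq]; decide +kernel
  have k0_10 : kr (4 * 10) (4 * (14 - 10)) 0 = 1 := by rw [kr_eq]; decide +kernel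
  have k0_11 : kr (4 * 11) (4 * (14 - 11)) 0 = 1 := by rw [kr_eq]; decide +kernel
  have k0_12 : kr (4 * 12) (4 * (14 - 12)) 0 = 1 := by rw [kr_eq]; decide +kernel
  have k0_13 : kr (4 * 13) (4 * (14 - 13)) 0 = 1 := by rw [kr_eq]; decide +kernel
  have k0_14 : kr (4 * 14) (4 * (14 - 14)) 0 = 1 := by rw [kr_eq]; decide +kernel
  have t0 := ht 0 (by norm_num)
  simp only [Finset.sum_range_succ, Finset.sum_range_zero, k0_0, k0_1, k0_2, k0_3, k0_4, k0_5, k0_6, k0_7, k0_8, k0_9, k0_10, k0_11, k0_12, k0_13, k0_14] at t0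
  norm_num at t0
  have k2_0 : kr (4 * 0) (4 * (14 - 0)) 2 = 1540 := by rw [kr_eq]; decide +kernel
  have k2_1 : kr (4 * 1) (4 * (14 - 1)) 2 = 1124 := by rw [kr_eq]; decide +kernel
  have k2_2 : kr (4 * 2) (4 * (14 - 2)) 2 = 772 := by rw [kr_eq]; decide +kernel
  have k2_3 : kr (4 * 3) (4 * (14 - 3)) 2 = 484 := by rw [kr_eq]; decide +kernel
  have k2_4 : kr (4 * 4) (4 * (14 - 4)) 2 = 260 := by rw [kr_eq]; decide +kernel
  have k2_5 : kr (4 * 5) (4 * (14 - 5)) 2 = 100 := by rw [kr_eq]; decide +kernel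
  have k2_6 : kr (4 * 6) (4 * (14 - 6)) 2 = 4 := by rw [kr_eq]; decide +kernel
  have k2_7 : kr (4 * 7) (4 * (14 - 7)) 2 = -28 := by rw [kr_eq]; decide +kernel
  have k2_8 : kr (4 * 8) (4 * (14 - 8)) 2 = 4 := by rw [kr_eq]; decide +kernel
  have k2_9 : kr (4 * 9) (4 * (14 - 9)) 2 = 100 := by rw [kr_eq]; decide +kernel
  have k2_10 : kr (4 * 10) (4 * (14 - 10)) 2 = 260 := by rw [kr_eq]; decide +kernel
  have k2_11 : kr (4 * 11) (4 * (14 - 11)) 2 = 484 := by rw [kr_eq]; decide +kernel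
  have k2_12 : kr (4 * 12) (4 * (14 - 12)) 2 = 772 := by rw [kr_eq]; decide +kernel
  have k2_13 : kr (4 * 13) (4 * (14 - 13)) 2 = 1124 := by rw [kr_eq]; decide +kernel
  have k2_14 : kr (4 * 14) (4 * (14 - 14)) 2 = 1540 := by rw [kr_eq]; decide +kernel
  have t2 := ht 2 (by norm_num)
  simp only [Finset.sum_range_succ, Finset.sum_range_zero, k2_0, k2_1, k2_2, k2_3, k2_4, k2_5, k2_6, k2_7, k2_8, k2_9, k2_10, k2_11, k2_12, k2_13, k2_14] at t2
  norm_num at t2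
  have k4_0 : kr (4 * 0) (4 * (14 - 0)) 4 = 367290 := by rw [kr_eq]; decide +kernel
  have k4_1 : kr (4 * 1) (4 * (14 - 1)) 4 = 190074 := by rw [kr_eq]; decide +kernel
  have k4_2 : kr (4 * 2) (4 * (14 - 2)) 4 = 85178 := by rw [kr_eq]; decide +kernel
  have k4_3 : kr (4 * 3) (4 * (14 - 3)) 4 = 30074 := by rw [kr_eq]; decide +kernel
  have k4_4 : kr (4 * 4) (4 * (14 - 4)) 4 = 6330 := by rw [kr_eq]; decide +kernel
  have k4_5 : kr (4 * 5) (4 * (14 - 5)) 4 = -390 := by rw [kr_eq]; decide +kernel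
  have k4_6 : kr (4 * 6) (4 * (14 - 6)) 4 = -326 := by rw [kr_eq]; decide +kernel
  have k4_7 : kr (4 * 7) (4 * (14 - 7)) 4 = 378 := by rw [kr_eq]; decide +kernel
  have k4_8 : kr (4 * 8) (4 * (14 - 8)) 4 = -326 := by rw [kr_eq]; decide +kernel
  have k4_9 : kr (4 * 9) (4 * (14 - 9)) 4 = -390 := by rw [kr_eq]; decide +kernel
  have k4_10 : kr (4 * 10) (4 * (14 - 10)) 4 = 6330 := by rw [kr_eq]; decide +kernel
  have k4_11 : kr (4 * 11) (4 * (14 - 11)) 4 = 30074 := by rw [kr_eq]; decide +kernel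
  have k4_12 : kr (4 * 12) (4 * (14 - 12)) 4 = 85178 := by rw [kr_eq]; decide +kernel
  have k4_13 : kr (4 * 13) (4 * (14 - 13)) 4 = 190074 := by rw [kr_eq]; decide +kernel
  have k4_14 : kr (4 * 14) (4 * (14 - 14)) 4 = 367290 := by rw [kr_eq]; decide +kernel
  have t4 := ht 4 (by norm_num)
  simp only [Finset.sum_range_succ, Finset.sum_range_zero, k4_0, k4_1, k4_2, k4_3, k4_4, k4_5, k4_6, k4_7, k4_8, k4_9, k4_10, k4_11, k4_12, k4_13, k4_14] at t4
  norm_num at t4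
  have k6_0 : kr (4 * 0) (4 * (14 - 0)) 6 = 32468436 := by rw [kr_eq]; decide +kernel
  have k6_1 : kr (4 * 1) (4 * (14 - 1)) 6 = 11499956 := by rw [kr_eq]; decide +kernel
  have k6_2 : kr (4 * 2) (4 * (14 - 2)) 6 = 3129044 := by rw [kr_eq]; decide +kernel
  have k6_3 : kr (4 * 3) (4 * (14 - 3)) 6 = 507188 := by rw [kr_eq]; decide +kernel
  have k6_4 : kr (4 * 4) (4 * (14 - 4)) 6 = -2860 := by rw [kr_eq]; decide +kernel
  have k6_5 : kr (4 * 5) (4 * (14 - 5)) 6 = -6732 := by rw [kr_eq]; decide +kernel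
  have k6_6 : kr (4 * 6) (4 * (14 - 6)) 6 = 4052 := by rw [kr_eq]; decide +kernel
  have k6_7 : kr (4 * 7) (4 * (14 - 7)) 6 = -3276 := by rw [kr_eq]; decide +kernel
  have k6_8 : kr (4 * 8) (4 * (14 - 8)) 6 = 4052 := by rw [kr_eq]; decide +kernel
  have k6_9 : kr (4 * 9) (4 * (14 - 9)) 6 = -6732 := by rw [kr_eq]; decide +kernel
  have k6_10 : kr (4 * 10) (4 * (14 - 10)) 6 = -2860 := by rw [kr_eq]; decide +kernel
  have k6_11 : kr (4 * 11) (4 * (14 - 11)) 6 = 507188 := by rw [kr_eq]; decide +kernel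
  have k6_12 : kr (4 * 12) (4 * (14 - 12)) 6 = 3129044 := by rw [kr_eq]; decide +kernel
  have k6_13 : kr (4 * 13) (4 * (14 - 13)) 6 = 11499956 := by rw [kr_eq]; decide +kernel
  have k6_14 : kr (4 * 14) (4 * (14 - 14)) 6 = 32468436 := by rw [kr_eq]; decide +kernel
  have t6 := ht 6 (by norm_num)
  simp only [Finset.sum_range_succ, Finset.sum_range_zero, k6_0, k6_1, k6_2, k6_3, k6_4, k6_5, k6_6, k6_7, k6_8, k6_9, k6_10, k6_11, k6_12, k6_13, k6_14] at t6
  norm_num at t6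
  have e3 := h2 (2) (by norm_num)
  simp only [Finset.sum_range_succ, Finset.sum_range_zero] at e3
  norm_num at e3
  have e4 := h2 (3) (by norm_num)
  simp only [Finset.sum_range_succ, Finset.sum_range_zero] at e4
  norm_num at e4
  have e5 := h2 (-2) (by norm_num)
  simp only [Finset.sum_range_succ, Finset.sum_range_zero] at e5
  norm_num at e5
  have e6 := h2 (4) (by norm_num)
  simp only [Finset.sum_range_succ, Finset.sum_range_zero] at e6
  norm_num at e6
  have e7 := h2 (-3) (by norm_num)
  simp only [Finset.sum_range_succ, Finset.sum_range_zero] at e7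
  norm_num at e7
  have e8 := h2 (5) (by norm_num)
  simp only [Finset.sum_range_succ, Finset.sum_range_zero] at e8
  norm_num at e8
  have e9 := h2 (-4) (by norm_num)
  simp only [Finset.sum_range_succ, Finset.sum_range_zero] at e9
  norm_num at e9
  have e10 := h1 (-1) (by norm_num)
  simp only [Finset.sum_range_succ, Finset.sum_range_zero] at e10
  norm_num at e10
  have e11 := h1 (3) (by norm_num)
  simp only [Finset.sum_range_succ, Finset.sum_range_zero] at e11
  norm_num at e11
  have e12 := h1 (-2) (by norm_num)
  simp only [Finset.sum_range_succ, Finset.sum_range_zero] at e12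
  norm_num at e12
  have e13 := h1 (4) (by norm_num)
  simp only [Finset.sum_range_succ, Finset.sum_range_zero] at e13
  norm_num at e13
  have e14 := h1 (-3) (by norm_num)
  simp only [Finset.sum_range_succ, Finset.sum_range_zero] at e14
  norm_num at e14
  have hf : (2 : ℂ) ^ 56 = 0 := by
    linear_combination -(1 : ℂ) * (t0 + (1053 / 27104) * t2 + (1 / 5082) * t4 + (-1 / 243936) * t6 + (14586008704 / 170188239375) * e3 + (59147488 / 161783881875) * e4 + (-445833088 / 132368630625) * e5 + (-35526828544 / 873424954276875) * e6 + (33909839 / 300455780625) * e7 + (522355 / 398376630729) * e8 + (-4791296 / 1782211242735) * e9 + (68210048 / 700363125) * e10 + (120631936 / 208007848125) * e11 + (-14956736 / 23111983125) * e12 + (-1634176 / 300455780625) * e13 + (15273472 / 2704102025625) * e14)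
  norm_num at hf

set_option maxHeartbeats 4000000 in
lemma contra16 (q : ℕ → ℂ)
    (h1 : ∀ X : ℂ, X ≠ 1 → ∑ j ∈ Finset.range (16 + 1), q j * X ^ j =
      ∑ j ∈ Finset.range (16 + 1), q j * (X ^ j * (X - 1) ^ (16 - j)))
    (h2 : ∀ X : ℂ, X ≠ 0 → ∑ j ∈ Finset.range (16 + 1), q j * X ^ j =
      ∑ j ∈ Finset.range (16 + 1), q j * X ^ (16 - j))
    (ht : ∀ k : ℕ, k < 8 → ∑ j ∈ Finset.range (16 + 1), q j * (kr (4 * j) (4 * (16 - j)) k : ℂ) =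
      if k = 0 then 2 ^ (4 * 16) else 0) : False := by
  have k0_0 : kr (4 * 0) (4 * (16 - 0)) 0 = 1 := by rw [kr_eq]; decide +kernel
  have k0_1 : kr (4 * 1) (4 * (16 - 1)) 0 = 1 := by rw [kr_eq]; decide +kernel
  have k0_2 : kr (4 * 2) (4 * (16 - 2)) 0 = 1 := by rw [kr_eq]; decide +kernel
  have k0_3 : kr (4 * 3) (4 * (16 - 3)) 0 = 1 := by rw [kr_eq]; decide +kernel
  have k0_4 : kr (4 * 4) (4 * (16 - 4)) 0 = 1 := by rw [kr_eq]; decide +kernel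
  have k0_5 : kr (4 * 5) (4 * (16 - 5)) 0 = 1 := by rw [kr_eq]; decide +kernel
  have k0_6 : kr (4 * 6) (4 * (16 - 6)) 0 = 1 := by rw [kr_eq]; decide +kernel
  have k0_7 : kr (4 * 7) (4 * (16 - 7)) 0 = 1 := by rw [kr_eq]; decide +kernel
  have k0_8 : kr (4 * 8) (4 * (16 - 8)) 0 = 1 := by rw [kr_eq]; decide +kernel
  have k0_9 : kr (4 * 9) (4 * (16 - 9)) 0 = 1 := by rw [kr_eq]; decide +kernel
  have k0_10 : kr (4 * 10) (4 * (16 - 10)) 0 = 1 := by rw [kr_eq]; decide +kernel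
  have k0_11 : kr (4 * 11) (4 * (16 - 11)) 0 = 1 := by rw [kr_eq]; decide +kernel
  have k0_12 : kr (4 * 12) (4 * (16 - 12)) 0 = 1 := by rw [kr_eq]; decide +kernel
  have k0_13 : kr (4 * 13) (4 * (16 - 13)) 0 = 1 := by rw [kr_eq]; decide +kernel
  have k0_14 : kr (4 * 14) (4 * (16 - 14)) 0 = 1 := by rw [kr_eq]; decide +kernel
  have k0_15 : kr (4 * 15) (4 * (16 - 15)) 0 = 1 := by rw [kr_eq]; decide +kernel
  have k0_16 : kr (4 * 16) (4 * (16 - 16)) 0 = 1 := by rw [kr_eq]; decide +kernel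
  have t0 := ht 0 (by norm_num)
  simp only [Finset.sum_range_succ, Finset.sum_range_zero, k0_0, k0_1, k0_2, k0_3, k0_4, k0_5, k0_6, k0_7, k0_8, k0_9, k0_10, k0_11, k0_12, k0_13, k0_14, k0_15, k0_16] at t0
  norm_num at t0
  have k2_0 : kr (4 * 0) (4 * (16 - 0)) 2 = 2016 := by rw [kr_eq]; decide +kernel
  have k2_1 : kr (4 * 1) (4 * (16 - 1)) 2 = 1536 := by rw [kr_eq]; decide +kernel
  have k2_2 : kr (4 * 2) (4 * (16 - 2)) 2 = 1120 := by rw [kr_eq]; decide +kernel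
  have k2_3 : kr (4 * 3) (4 * (16 - 3)) 2 = 768 := by rw [kr_eq]; decide +kernel
  have k2_4 : kr (4 * 4) (4 * (16 - 4)) 2 = 480 := by rw [kr_eq]; decide +kernel
  have k2_5 : kr (4 * 5) (4 * (16 - 5)) 2 = 256 := by rw [kr_eq]; decide +kernel
  have k2_6 : kr (4 * 6) (4 * (16 - 6)) 2 = 96 := by rw [kr_eq]; decide +kernel
  have k2_7 : kr (4 * 7) (4 * (16 - 7)) 2 = 0 := by rw [kr_eq]; decide +kernel
  have k2_8 : kr (4 * 8) (4 * (16 - 8)) 2 = -32 := by rw [kr_eq]; decide +kernel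
  have k2_9 : kr (4 * 9) (4 * (16 - 9)) 2 = 0 := by rw [kr_eq]; decide +kernel
  have k2_10 : kr (4 * 10) (4 * (16 - 10)) 2 = 96 := by rw [kr_eq]; decide +kernel
  have k2_11 : kr (4 * 11) (4 * (16 - 11)) 2 = 256 := by rw [kr_eq]; decide +kernel
  have k2_12 : kr (4 * 12) (4 * (16 - 12)) 2 = 480 := by rw [kr_eq]; decide +kernel
  have k2_13 : kr (4 * 13) (4 * (16 - 13)) 2 = 768 := by rw [kr_eq]; decide +kernel
  have k2_14 : kr (4 * 14) (4 * (16 - 14)) 2 = 1120 := by rw [kr_eq]; decide +kernel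
  have k2_15 : kr (4 * 15) (4 * (16 - 15)) 2 = 1536 := by rw [kr_eq]; decide +kernel
  have k2_16 : kr (4 * 16) (4 * (16 - 16)) 2 = 2016 := by rw [kr_eq]; decide +kernel
  have t2 := ht 2 (by norm_num)
  simp only [Finset.sum_range_succ, Finset.sum_range_zero, k2_0, k2_1, k2_2, k2_3, k2_4, k2_5, k2_6, k2_7, k2_8, k2_9, k2_10, k2_11, k2_12, k2_13, k2_14, k2_15, k2_16] at t2
  norm_num at t2
  have k4_0 : kr (4 * 0) (4 * (16 - 0)) 4 = 635376 := by rw [kr_eq]; decide +kernel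
  have k4_1 : kr (4 * 1) (4 * (16 - 1)) 4 = 361136 := by rw [kr_eq]; decide +kernel
  have k4_2 : kr (4 * 2) (4 * (16 - 2)) 4 = 185584 := by rw [kr_eq]; decide +kernel
  have k4_3 : kr (4 * 3) (4 * (16 - 3)) 4 = 82096 := by rw [kr_eq]; decide +kernel
  have k4_4 : kr (4 * 4) (4 * (16 - 4)) 4 = 28144 := by rw [kr_eq]; decide +kernel
  have k4_5 : kr (4 * 5) (4 * (16 - 5)) 4 = 5296 := by rw [kr_eq]; decide +kernel
  have k4_6 : kr (4 * 6) (4 * (16 - 6)) 4 = -784 := by rw [kr_eq]; decide +kernel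
  have k4_7 : kr (4 * 7) (4 * (16 - 7)) 4 = -336 := by rw [kr_eq]; decide +kernel
  have k4_8 : kr (4 * 8) (4 * (16 - 8)) 4 = 496 := by rw [kr_eq]; decide +kernel
  have k4_9 : kr (4 * 9) (4 * (16 - 9)) 4 = -336 := by rw [kr_eq]; decide +kernel
  have k4_10 : kr (4 * 10) (4 * (16 - 10)) 4 = -784 := by rw [kr_eq]; decide +kernel
  have k4_11 : kr (4 * 11) (4 * (16 - 11)) 4 = 5296 := by rw [kr_eq]; decide +kernel
  have k4_12 : kr (4 * 12) (4 * (16 - 12)) 4 = 28144 := by rw [kr_eq]; decide +kernel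
  have k4_13 : kr (4 * 13) (4 * (16 - 13)) 4 = 82096 := by rw [kr_eq]; decide +kernel
  have k4_14 : kr (4 * 14) (4 * (16 - 14)) 4 = 185584 := by rw [kr_eq]; decide +kernel
  have k4_15 : kr (4 * 15) (4 * (16 - 15)) 4 = 361136 := by rw [kr_eq]; decide +kernel
  have k4_16 : kr (4 * 16) (4 * (16 - 16)) 4 = 635376 := by rw [kr_eq]; decide +kernel
  have t4 := ht 4 (by norm_num)
  simp only [Finset.sum_range_succ, Finset.sum_range_zero, k4_0, k4_1, k4_2, k4_3, k4_4, k4_5, k4_6, k4_7, k4_8, k4_9, k4_10, k4_11, k4_12, k4_13, k4_14, k4_15, k4_16] at t4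
  norm_num at t4
  have k6_0 : kr (4 * 0) (4 * (16 - 0)) 6 = 74974368 := by rw [kr_eq]; decide +kernel
  have k6_1 : kr (4 * 1) (4 * (16 - 1)) 6 = 31008512 := by rw [kr_eq]; decide +kernel
  have k6_2 : kr (4 * 2) (4 * (16 - 2)) 6 = 10746400 := by rw [kr_eq]; decide +kernel
  have k6_3 : kr (4 * 3) (4 * (16 - 3)) 6 = 2792960 := by rw [kr_eq]; decide +kernel
  have k6_4 : kr (4 * 4) (4 * (16 - 4)) 6 = 389792 := by rw [kr_eq]; decide +kernel
  have k6_5 : kr (4 * 5) (4 * (16 - 5)) 6 = -26624 := by rw [kr_eq]; decide +kernel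
  have k6_6 : kr (4 * 6) (4 * (16 - 6)) 6 = -4576 := by rw [kr_eq]; decide +kernel
  have k6_7 : kr (4 * 7) (4 * (16 - 7)) 6 = 5376 := by rw [kr_eq]; decide +kernel
  have k6_8 : kr (4 * 8) (4 * (16 - 8)) 6 = -4960 := by rw [kr_eq]; decide +kernel
  have k6_9 : kr (4 * 9) (4 * (16 - 9)) 6 = 5376 := by rw [kr_eq]; decide +kernel
  have k6_10 : kr (4 * 10) (4 * (16 - 10)) 6 = -4576 := by rw [kr_eq]; decide +kernel
  have k6_11 : kr (4 * 11) (4 * (16 - 11)) 6 = -26624 := by rw [kr_eq]; decide +kernel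
  have k6_12 : kr (4 * 12) (4 * (16 - 12)) 6 = 389792 := by rw [kr_eq]; decide +kernel
  have k6_13 : kr (4 * 13) (4 * (16 - 13)) 6 = 2792960 := by rw [kr_eq]; decide +kernel
  have k6_14 : kr (4 * 14) (4 * (16 - 14)) 6 = 10746400 := by rw [kr_eq]; decide +kernel
  have k6_15 : kr (4 * 15) (4 * (16 - 15)) 6 = 31008512 := by rw [kr_eq]; decide +kernel
  have k6_16 : kr (4 * 16) (4 * (16 - 16)) 6 = 74974368 := by rw [kr_eq]; decide +kernel
  have t6 := ht 6 (by norm_num)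
  simp only [Finset.sum_range_succ, Finset.sum_range_zero, k6_0, k6_1, k6_2, k6_3, k6_4, k6_5, k6_6, k6_7, k6_8, k6_9, k6_10, k6_11, k6_12, k6_13, k6_14, k6_15, k6_16] at t6
  norm_num at t6
  have e3 := h2 (2) (by norm_num)
  simp only [Finset.sum_range_succ, Finset.sum_range_zero] at e3
  norm_num at e3
  have e4 := h2 (3) (by norm_num)
  simp only [Finset.sum_range_succ, Finset.sum_range_zero] at e4
  norm_num at e4
  have e5 := h2 (-2) (by norm_num)
  simp only [Finset.sum_range_succ, Finset.sum_range_zero] at e5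
  norm_num at e5
  have e6 := h2 (4) (by norm_num)
  simp only [Finset.sum_range_succ, Finset.sum_range_zero] at e6
  norm_num at e6
  have e7 := h2 (-3) (by norm_num)
  simp only [Finset.sum_range_succ, Finset.sum_range_zero] at e7
  norm_num at e7
  have e8 := h2 (5) (by norm_num)
  simp only [Finset.sum_range_succ, Finset.sum_range_zero] at e8
  norm_num at e8
  have e9 := h2 (-4) (by norm_num)
  simp only [Finset.sum_range_succ, Finset.sum_range_zero] at e9
  norm_num at e9
  have e10 := h1 (-1) (by norm_num)
  simp only [Finset.sum_range_succ, Finset.sum_range_zero] at e10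
  norm_num at e10
  have e11 := h1 (3) (by norm_num)
  simp only [Finset.sum_range_succ, Finset.sum_range_zero] at e11
  norm_num at e11
  have e12 := h1 (-2) (by norm_num)
  simp only [Finset.sum_range_succ, Finset.sum_range_zero] at e12
  norm_num at e12
  have e13 := h1 (4) (by norm_num)
  simp only [Finset.sum_range_succ, Finset.sum_range_zero] at e13
  norm_num at e13
  have e14 := h1 (-3) (by norm_num)
  simp only [Finset.sum_range_succ, Finset.sum_range_zero] at e14
  norm_num at e14
  have e15 := h1 (5) (by norm_num)
  simp only [Finset.sum_range_succ, Finset.sum_range_zero] at e15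
  norm_num at e15
  have e16 := h1 (6) (by norm_num)
  simp only [Finset.sum_range_succ, Finset.sum_range_zero] at e16
  norm_num at e16
  have hf : (2 : ℂ) ^ 64 = 0 := by
    linear_combination -(1 : ℂ) * (t0 + (101 / 1344) * t2 + (9 / 3472) * t4 + (-1 / 41664) * t6 + (-26945859736 / 43601945625) * e3 + (3902044 / 1256023125) * e4 + (-355515544 / 124346289375) * e5 + (-183616729 / 4387647639375) * e6 + (82162573 / 1950065617500) * e7 + (233861 / 408253737276) * e8 + (-300227 / 510317171595) * e9 + (-6562197496 / 11304208125) * e10 + (-242378888 / 41448763125) * e11 + (105838421 / 55265017500) * e12 + (595001989 / 3412614830625) * e13 + (-334837103 / 30713533475625) * e14 + (-114937 / 18900635985) * e15 + (193 / 1374591708) * e16)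
  norm_num at hf

lemma no_min32 (n : ℕ) (hn : n ∈ ({48, 56, 64} : Set ℕ))
    (C : Submodule (ZMod 4) (Fin n → ZMod 4))
    (hC : IsTypeIIZ4 (C : Set (Fin n → ZMod 4)))
    (hmin : ∀ v ∈ C, v ≠ 0 → 32 ≤ euclWt v) : False := by
  simp only [Set.mem_insert_iff, Set.mem_singleton_iff] at hn
  rcases hn with rfl | rfl | rfl
  · have ht := q_trunc (N := 12) C hC hmin
    simp only [coeff_kr] at ht
    exact contra12 (fun j => (rpoly C).coeff (4 * j)) (q_sym1 (N := 12) C hC)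
      (q_sym2 (N := 12) C hC) ht
  · have ht := q_trunc (N := 14) C hC hmin
    simp only [coeff_kr] at ht
    exact contra14 (fun j => (rpoly C).coeff (4 * j)) (q_sym1 (N := 14) C hC)
      (q_sym2 (N := 14) C hC) ht
  · have ht := q_trunc (N := 16) C hC hmin
    simp only [coeff_kr] at ht
    exact contra16 (fun j => (rpoly C).coeff (4 * j)) (q_sym1 (N := 16) C hC)
      (q_sym2 (N := 16) C hC) ht

/-! ### The lattice -/

lemma wt_le_sq (s : ℤ) :
    (if (s : ZMod 4) = 0 then 0 else if (s : ZMod 4) = 2 then 4 else 1 : ℤ) ≤ s ^ 2 := by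
  have d0 : ((s : ZMod 4) = 0) ↔ (4 : ℤ) ∣ s := by
    simpa using (ZMod.intCast_zmod_eq_zero_iff_dvd s 4)
  have d2 : ((s : ZMod 4) = 2) ↔ (4 : ℤ) ∣ (2 - s) := by
    have := ZMod.intCast_eq_intCast_iff_dvd_sub s 2 4
    simpa using this
  split_ifs with h0 h2
  · positivity
  · rw [d2] at h2
    have : s ≤ -2 ∨ 2 ≤ s := by omega
    rcases this with h | h <;> nlinarith
  · have : s ≠ 0 := by rintro rfl; exact h0 (by simp)
    have : s ≤ -1 ∨ 1 ≤ s := by omega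
    rcases this with h | h <;> nlinarith

lemma euclWt_le {n : ℕ} (z : Fin n → ℤ) :
    (euclWt (fun i => (z i : ZMod 4)) : ℤ) ≤ ∑ i, z i ^ 2 := by
  unfold euclWt
  push_cast
  exact Finset.sum_le_sum fun i _ => wt_le_sq (z i)

lemma rInner_eq {n : ℕ} (x : Fin n → ℝ) (z : Fin n → ℤ) (h : ∀ i, 2 * x i = (z i : ℝ)) :
    4 * rInner x x = ((∑ i, z i ^ 2 : ℤ) : ℝ) := by
  unfold rInner
  push_cast
  rw [Finset.mul_sum]
  refine Finset.sum_congr rfl fun i _ => ?_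
  rw [← h i]; ring

/-- minimal lift -/
def mlift (s : ZMod 4) : ℤ := if s = 0 then 0 else if s = 1 then 1 else if s = 2 then 2 else -1

lemma mlift_cast (s : ZMod 4) : ((mlift s : ℤ) : ZMod 4) = s := by
  revert s; decide

lemma mlift_sq (s : ZMod 4) :
    mlift s ^ 2 = if s = 0 then 0 else if s = 2 then 4 else 1 := by
  revert s; decide

lemma exists_lift {n : ℕ} (C : Set (Fin n → ZMod 4)) (v : Fin n → ZMod 4) (hv : v ∈ C) :
    (fun i => (mlift (v i) : ℝ) / 2) ∈ A4lattice C ∧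
    4 * rInner (fun i => (mlift (v i) : ℝ) / 2) (fun i => (mlift (v i) : ℝ) / 2) = euclWt v := by
  have h : ∀ i, 2 * ((mlift (v i) : ℝ) / 2) = (mlift (v i) : ℝ) := fun i => by ring
  refine ⟨⟨fun i => mlift (v i), h, ?_⟩, ?_⟩
  · simpa only [mlift_cast] using hv
  · rw [rInner_eq _ (fun i => mlift (v i)) h]
    unfold euclWt
    simp only [mlift_sq]
    push_cast
    rfl

/-- the frame vectors -/
noncomputable def frame {n : ℕ} (p : Fin n × Bool) : Fin n → ℝ :=
  Pi.single p.1 (if p.2 then 2 else -2)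

lemma frame_inj {n : ℕ} : Function.Injective (frame (n := n)) := by
  rintro ⟨i, a⟩ ⟨j, b⟩ h
  have hi := congrFun h i
  have hne : (if a then (2 : ℝ) else -2) ≠ 0 := by split_ifs <;> norm_num
  by_cases hij : i = j
  · subst hij
    simp only [frame, Pi.single_eq_same] at hi
    cases a <;> cases b <;> norm_num at hi <;> rfl
  · simp only [frame, Pi.single_eq_same, Pi.single_eq_of_ne hij] at hi
    exact absurd hi hne

lemma frame_ncard {n : ℕ} : (Set.range (frame (n := n))).ncard = 2 * n := by
  rw [← Set.image_univ, Set.ncard_image_of_injective _ frame_inj, Set.ncard_univ]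
  simp [mul_comm]

lemma frame_mem {n : ℕ} (C : Submodule (ZMod 4) (Fin n → ZMod 4)) (p : Fin n × Bool) :
    frame p ∈ A4lattice (C : Set (Fin n → ZMod 4)) ∧ rInner (frame p) (frame p) = 4 := by
  constructor
  · refine ⟨Pi.single p.1 (if p.2 then 4 else -4), fun i => ?_, ?_⟩
    · by_cases h : i = p.1
      · subst h
        simp only [frame, Pi.single_eq_same]
        split_ifs <;> norm_num
      · simp [frame, Pi.single_eq_of_ne h]
    · have : (fun i => (((Pi.single p.1 (if p.2 then 4 else -4) : Fin n → ℤ) i : ℤ) : ZMod 4)) = 0 := by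
        funext i
        by_cases h : i = p.1
        · subst h
          simp only [Pi.single_eq_same, Pi.zero_apply]
          split_ifs <;> decide
        · simp [Pi.single_eq_of_ne h]
      rw [this]
      exact C.zero_mem
  · unfold rInner frame
    rw [Finset.sum_eq_single p.1]
    · simp only [Pi.single_eq_same]
      split_ifs <;> norm_num
    · intro b _ hb
      simp [Pi.single_eq_of_ne hb]
    · simp

/-- vectors in the lattice coming from the zero codeword -/
lemma zero_word {n : ℕ} (x : Fin n → ℝ) (z : Fin n → ℤ) (h : ∀ i, 2 * x i = (z i : ℝ))
    (hz : (fun i => (z i : ZMod 4)) = 0) (hx : x ≠ 0) :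
    4 ≤ rInner x x ∧ (rInner x x = 4 → x ∈ Set.range (frame (n := n))) := by
  have hd : ∀ i, ∃ u : ℤ, x i = 2 * u := by
    intro i
    have h1 : (z i : ZMod 4) = 0 := congrFun hz i
    have h2 : (4 : ℤ) ∣ z i := by
      simpa using (ZMod.intCast_zmod_eq_zero_iff_dvd (z i) 4).mp h1
    obtain ⟨u, hu⟩ := h2
    refine ⟨u, ?_⟩
    have := h i
    rw [hu] at this
    push_cast at this
    linarith
  choose u hu using hd
  obtain ⟨i, hi⟩ : ∃ i, x i ≠ 0 := by
    by_contra hcon; push Not at hcon; exact hx (funext hcon)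
  have hui : u i ≠ 0 := by
    intro h0; apply hi; rw [hu i, h0]; simp
  have hr : rInner x x = 4 * ((∑ j, u j ^ 2 : ℤ) : ℝ) := by
    unfold rInner
    push_cast
    rw [Finset.mul_sum]
    exact Finset.sum_congr rfl fun j _ => by rw [hu j]; ring
  have h1 : 1 ≤ u i ^ 2 := by
    have := sq_nonneg (u i)
    have h0 : u i ^ 2 ≠ 0 := pow_ne_zero _ hui
    omega
  have hsum : ∑ j, u j ^ 2 = u i ^ 2 + ∑ j ∈ Finset.univ.erase i, u j ^ 2 :=
    (Finset.add_sum_erase _ _ (Finset.mem_univ i)).symm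
  have hnn : 0 ≤ ∑ j ∈ Finset.univ.erase i, u j ^ 2 := Finset.sum_nonneg fun j _ => sq_nonneg _
  constructor
  · rw [hr]
    have : (1 : ℝ) ≤ ((∑ j, u j ^ 2 : ℤ) : ℝ) := by
      exact_mod_cast (by omega : (1 : ℤ) ≤ ∑ j, u j ^ 2)
    linarith
  · intro h4
    rw [hr] at h4
    have h5 : (∑ j, u j ^ 2 : ℤ) = 1 := by
      have : ((∑ j, u j ^ 2 : ℤ) : ℝ) = 1 := by linarith
      exact_mod_cast this
    have h6 : ∑ j ∈ Finset.univ.erase i, u j ^ 2 = 0 := by omega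
    have h7 : u i ^ 2 = 1 := by omega
    have h8 : ∀ j, j ≠ i → u j = 0 := by
      intro j hj
      have := (Finset.sum_eq_zero_iff_of_nonneg (fun j _ => sq_nonneg (u j))).mp h6 j
        (by simp [hj])
      exact pow_eq_zero_iff (two_ne_zero) |>.mp this
    rcases (sq_eq_sq_iff_eq_or_eq_neg.mp (h7.trans (one_pow 2).symm)) with h | h
    · refine ⟨(i, true), ?_⟩
      funext j
      by_cases hj : j = i
      · subst hj; simp [frame, hu j, h]
      · simp [frame, hu j, h8 j hj, Pi.single_eq_of_ne hj]
    · refine ⟨(i, false), ?_⟩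
      funext j
      by_cases hj : j = i
      · subst hj; simp [frame, hu j, h]
      · simp [frame, hu j, h8 j hj, Pi.single_eq_of_ne hj]

lemma frame_int {n : ℕ} (p : Fin n × Bool) (i : Fin n) (s : ZMod 4)
    (h : frame p i = (mlift s : ℝ) / 2) : s = 0 := by
  have h2 : (mlift s : ℝ) = ((2 * (if i = p.1 then (if p.2 then 2 else -2) else 0) : ℤ) : ℝ) := by
    have : (mlift s : ℝ) = 2 * frame p i := by rw [h]; ring
    rw [this]
    by_cases hi : i = p.1
    · subst hi
      simp only [frame, Pi.single_eq_same]
      split_ifs <;> norm_num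
    · simp [frame, hi]
  have h3 : mlift s = 2 * (if i = p.1 then (if p.2 then 2 else -2) else 0) := by exact_mod_cast h2
  have h4 : mlift s ≤ 2 ∧ -2 < mlift s ∧ (mlift s = 0 → s = 0) := by
    clear h h2 h3; revert s; decide
  apply h4.2.2
  split_ifs at h3 <;> omega

theorem stmt7 {n : ℕ} (hn : n ∈ ({48, 56, 64} : Set ℕ))
    (C : Submodule (ZMod 4) (Fin n → ZMod 4))
    (hC : IsTypeIIZ4 (C : Set (Fin n → ZMod 4))) :
    IsExtremalTypeIIZ4 n (C : Set (Fin n → ZMod 4)) ↔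
      (IsLeast {r : ℝ | ∃ x ∈ A4lattice (C : Set (Fin n → ZMod 4)), x ≠ 0 ∧ rInner x x = r} 4 ∧
       {x ∈ A4lattice (C : Set (Fin n → ZMod 4)) | rInner x x = 4}.ncard = 2 * n) := by
  have hb : 8 * (n / 24) + 8 = 24 := by
    simp only [Set.mem_insert_iff, Set.mem_singleton_iff] at hn
    rcases hn with rfl | rfl | rfl <;> norm_num
  have hpos : 0 < n := by
    simp only [Set.mem_insert_iff, Set.mem_singleton_iff] at hn
    omega
  have hsub : Set.range (frame (n := n)) ⊆
      {x ∈ A4lattice (C : Set (Fin n → ZMod 4)) | rInner x x = 4} := by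
    rintro _ ⟨p, rfl⟩
    exact frame_mem C p
  unfold IsExtremalTypeIIZ4
  rw [hb]
  constructor
  · rintro ⟨-, hinf⟩
    have hmin : ∀ v ∈ C, v ≠ 0 → 24 ≤ euclWt v := by
      intro v hv hv0
      rw [← hinf]
      exact Nat.sInf_le ⟨v, ⟨hv, by simpa using hv0⟩, rfl⟩
    have hx : ∀ x ∈ A4lattice (C : Set (Fin n → ZMod 4)), x ≠ 0 →
        4 ≤ rInner x x ∧ (rInner x x = 4 → x ∈ Set.range (frame (n := n))) := by
      rintro x ⟨z, h, hz⟩ hx0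
      by_cases hz0 : (fun i => (z i : ZMod 4)) = 0
      · exact zero_word x z h hz0 hx0
      · have h1 := hmin _ hz hz0
        have h2 := euclWt_le z
        have h3 := rInner_eq x z h
        have h4 : (24 : ℝ) ≤ ((∑ i, z i ^ 2 : ℤ) : ℝ) := by
          exact_mod_cast (by omega : (24 : ℤ) ≤ ∑ i, z i ^ 2)
        exact ⟨by linarith, fun h5 => by linarith⟩
    refine ⟨⟨?_, ?_⟩, ?_⟩
    · obtain ⟨h1, h2⟩ := frame_mem C (⟨0, hpos⟩, true)
      refine ⟨_, h1, ?_, h2⟩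
      intro h0
      rw [h0] at h2
      simp [rInner] at h2
    · rintro r ⟨x, hxm, hx0, rfl⟩
      exact (hx x hxm hx0).1
    · rw [← frame_ncard (n := n)]
      congr 1
      refine Set.Subset.antisymm ?_ hsub
      rintro x ⟨hxm, hx4⟩
      refine (hx x hxm ?_).2 hx4
      rintro rfl
      simp [rInner] at hx4
  · rintro ⟨hleast, hcard⟩
    refine ⟨hC, ?_⟩
    have hfin : {x ∈ A4lattice (C : Set (Fin n → ZMod 4)) | rInner x x = 4}.Finite :=
      Set.finite_of_ncard_pos (by omega)
    have heq := Set.eq_of_subset_of_ncard_le hsub (by rw [hcard, frame_ncard]) hfin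
    have hmin : ∀ v ∈ C, v ≠ 0 → 24 ≤ euclWt v := by
      intro v hv hv0
      obtain ⟨h1, h2⟩ := exists_lift (C : Set (Fin n → ZMod 4)) v hv
      set x : Fin n → ℝ := fun i => (mlift (v i) : ℝ) / 2 with hxdef
      have hx0 : x ≠ 0 := by
        intro h0
        apply hv0
        funext i
        have h3 : (mlift (v i) : ℝ) / 2 = 0 := congrFun h0 i
        have h4 : (mlift (v i) : ℝ) = 0 := by linarith
        have h5 : mlift (v i) = 0 := by exact_mod_cast h4
        rw [← mlift_cast (v i), h5]; simp
      have h4 : 4 ≤ rInner x x := hleast.2 ⟨x, h1, hx0, rfl⟩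
      have h5 : (16 : ℝ) ≤ (euclWt v : ℝ) := by linarith
      have h6 : 16 ≤ euclWt v := by exact_mod_cast h5
      have h7 : euclWt v ≠ 16 := by
        intro h16
        rw [h16] at h2
        have h8 : rInner x x = 4 := by
          push_cast at h2
          linarith
        have h9 : x ∈ Set.range (frame (n := n)) := by
          rw [heq]; exact ⟨h1, h8⟩
        obtain ⟨p, hp⟩ := h9
        apply hv0
        funext i
        exact frame_int p i (v i) (congrFun hp i)
      have h8 := hC.2 v hv
      omega
    have hex : ∃ v ∈ C, v ≠ 0 ∧ euclWt v = 24 := by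
      by_contra hcon
      push Not at hcon
      refine no_min32 n hn C hC fun v hv hv0 => ?_
      have h1 := hmin v hv hv0
      have h2 := hcon v hv hv0
      have h3 := hC.2 v hv
      omega
    obtain ⟨v, hv, hv0, hw⟩ := hex
    apply le_antisymm
    · exact Nat.sInf_le ⟨v, ⟨hv, by simpa using hv0⟩, hw⟩
    · refine le_csInf ⟨_, v, ⟨hv, by simpa using hv0⟩, rfl⟩ ?_
      rintro _ ⟨w, ⟨hw1, hw2⟩, rfl⟩
      exact hmin w hw1 (by simpa using hw2)
end

section
/- There exist at least nine pairwise inequivalent extremal Type II Z4-codes of length 64, i.e., there exist extremal Type II Z4-codes C₁, …, C₉ ⊆ (ZMod 4)^64 such that for all i ≠ j, Cᵢ and Cⱼ are not monomially equivalent. -/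
open Finset

/-! ### General construction of Type II codes from self-orthogonal generators -/

namespace Z4Ext

abbrev V4 := Fin 64 → ZMod 4
abbrev V2 := Fin 64 → ZMod 2

def redHom : ZMod 4 →+* ZMod 2 := ZMod.castHom (by norm_num : (2:ℕ) ∣ 4) (ZMod 2)

def red (x : V4) : V2 := fun i => redHom (x i)

theorem red_add (x y : V4) : red (x + y) = red x + red y := by
  funext i; simp [red]

theorem red_sub (x y : V4) : red (x - y) = red x - red y := by
  funext i; simp [red]

theorem red_zero : red 0 = 0 := by
  funext i; simp [red]

theorem red_smul (a : ZMod 4) (x : V4) : red (a • x) = redHom a • red x := by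
  funext i; simp [red]

theorem inner_add_left (x y z : V4) : z4Inner (x + y) z = z4Inner x z + z4Inner y z := by
  simp [z4Inner, add_mul, Finset.sum_add_distrib]

theorem inner_comm (x y : V4) : z4Inner x y = z4Inner y x := by
  simp [z4Inner, mul_comm]

theorem inner_add_right (x y z : V4) : z4Inner z (x + y) = z4Inner z x + z4Inner z y := by
  rw [inner_comm, inner_add_left, inner_comm x, inner_comm y]

theorem inner_smul_left (a : ZMod 4) (x z : V4) : z4Inner (a • x) z = a * z4Inner x z := by
  simp [z4Inner, Finset.mul_sum, mul_assoc]

theorem inner_zero_left (z : V4) : z4Inner 0 z = 0 := by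
  simp [z4Inner]

theorem inner_span {S : Set V4} {x : V4} (h : ∀ s ∈ S, z4Inner x s = 0) :
    ∀ s ∈ Submodule.span (ZMod 4) S, z4Inner x s = 0 := by
  intro s hs
  induction hs using Submodule.span_induction with
  | mem s hs => exact h s hs
  | zero => rw [inner_comm, inner_zero_left]
  | add a b _ _ ha hb => rw [inner_add_right, ha, hb, add_zero]
  | smul c a _ ha => rw [inner_comm, inner_smul_left, inner_comm, ha, mul_zero]

theorem inner_even_even {d e : V4} (hd : red d = 0) (he : red e = 0) : z4Inner d e = 0 := by
  have key : ∀ a b : ZMod 4, redHom a = 0 → redHom b = 0 → a * b = 0 := by decide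
  exact Finset.sum_eq_zero fun i _ => key _ _ (congrFun hd i) (congrFun he i)

/-- The code attached to a set of generators. -/
def code (S : Set V4) : Submodule (ZMod 4) V4 where
  carrier := {x | (∀ s ∈ S, z4Inner x s = 0) ∧ red x ∈ Submodule.span (ZMod 2) (red '' S)}
  zero_mem' := ⟨fun s _ => inner_zero_left s, by rw [red_zero]; exact Submodule.zero_mem _⟩
  add_mem' := by
    rintro x y ⟨hx, hx'⟩ ⟨hy, hy'⟩
    refine ⟨fun s hs => ?_, ?_⟩
    · rw [inner_add_left, hx s hs, hy s hs, add_zero]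
    · rw [red_add]; exact Submodule.add_mem _ hx' hy'
  smul_mem' := by
    rintro a x ⟨hx, hx'⟩
    refine ⟨fun s hs => ?_, ?_⟩
    · rw [inner_smul_left, hx s hs, mul_zero]
    · rw [red_smul]; exact Submodule.smul_mem _ _ hx'

theorem mem_code {S : Set V4} {x : V4} : x ∈ code S ↔
    (∀ s ∈ S, z4Inner x s = 0) ∧ red x ∈ Submodule.span (ZMod 2) (red '' S) := Iff.rfl

theorem exists_lift {S : Set V4} {y : V2} (hy : y ∈ Submodule.span (ZMod 2) (red '' S)) :
    ∃ s ∈ Submodule.span (ZMod 4) S, red s = y := by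
  induction hy using Submodule.span_induction with
  | mem y hy =>
    obtain ⟨s, hs, rfl⟩ := hy
    exact ⟨s, Submodule.subset_span hs, rfl⟩
  | zero => exact ⟨0, Submodule.zero_mem _, red_zero⟩
  | add a b _ _ ha hb =>
    obtain ⟨s, hs, rfl⟩ := ha
    obtain ⟨t, ht, rfl⟩ := hb
    exact ⟨s + t, Submodule.add_mem _ hs ht, red_add s t⟩
  | smul c a _ ha =>
    obtain ⟨s, hs, rfl⟩ := ha
    have hc : ∃ c' : ZMod 4, redHom c' = c := by
      revert c; decide
    obtain ⟨c', rfl⟩ := hc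
    exact ⟨c' • s, Submodule.smul_mem _ _ hs, red_smul c' s⟩

theorem span_le_code {S : Set V4} (hS : ∀ s ∈ S, ∀ t ∈ S, z4Inner s t = 0) :
    Submodule.span (ZMod 4) S ≤ code S := by
  rw [Submodule.span_le]
  intro s hs
  exact ⟨fun t ht => hS s hs t ht, Submodule.subset_span ⟨s, hs, rfl⟩⟩

theorem code_decomp {S : Set V4} (hS : ∀ s ∈ S, ∀ t ∈ S, z4Inner s t = 0)
    {x : V4} (hx : x ∈ code S) :
    ∃ s ∈ Submodule.span (ZMod 4) S, ∃ d ∈ code S, red d = 0 ∧ x = s + d := by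
  obtain ⟨s, hs, hsx⟩ := exists_lift hx.2
  refine ⟨s, hs, x - s, Submodule.sub_mem _ hx (span_le_code hS hs), ?_, by abel⟩
  rw [red_sub, hsx, sub_self]

theorem code_selforth {S : Set V4} (hS : ∀ s ∈ S, ∀ t ∈ S, z4Inner s t = 0)
    {x y : V4} (hx : x ∈ code S) (hy : y ∈ code S) : z4Inner x y = 0 := by
  obtain ⟨s, hs, d, hd, hd0, rfl⟩ := code_decomp hS hx
  obtain ⟨s', hs', e, he, he0, rfl⟩ := code_decomp hS hy
  rw [inner_add_left, inner_comm s, inner_span (mem_code.1 hy).1 s hs, inner_add_right,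
    inner_span hd.1 s' hs', inner_even_even hd0 he0]
  simp

def e2 : ZMod 2 →+ ZMod 4 where
  toFun a := if a = 0 then 0 else 2
  map_zero' := by decide
  map_add' := by decide

theorem e2_mul : ∀ (a : ZMod 2) (b : ZMod 4), e2 (a * redHom b) = e2 a * b := by decide

theorem e2_ne : ∀ a : ZMod 2, e2 a = 0 → a = 0 := by decide

theorem red_e2 : ∀ a : ZMod 2, redHom (e2 a) = 0 := by decide

theorem code_selfdual {S : Set V4} (hS : ∀ s ∈ S, ∀ t ∈ S, z4Inner s t = 0) :
    IsSelfDualZ4 (code S : Set V4) := by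
  apply Set.Subset.antisymm
  · intro x hx c hc
    exact code_selforth hS hx hc
  · intro x hx
    refine ⟨fun s hs => hx s (span_le_code hS (Submodule.subset_span hs)), ?_⟩
    by_contra hcon
    obtain ⟨f, hf, hker⟩ := Submodule.exists_le_ker_of_notMem hcon
    set d : V4 := fun i => e2 (f (Pi.single i 1)) with hd
    have key : ∀ y : V4, z4Inner d y = e2 (f (red y)) := by
      intro y
      rw [LinearMap.pi_apply_eq_sum_univ f (red y), map_sum]
      unfold z4Inner
      refine Finset.sum_congr rfl fun i _ => ?_
      rw [hd, ← e2_mul]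
      congr 1
      rw [smul_eq_mul, mul_comm]
      congr 2
      funext j
      simp [Pi.single_apply, eq_comm]
    have hdC : d ∈ code S := by
      refine ⟨fun s hs => ?_, ?_⟩
      · rw [key]
        have : f (red s) = 0 := hker (Submodule.subset_span ⟨s, hs, rfl⟩)
        rw [this, map_zero]
      · have : red d = 0 := by
          funext i; exact red_e2 _
        rw [this]; exact Submodule.zero_mem _
    have h0 := hx d hdC
    rw [inner_comm, key] at h0
    exact hf (e2_ne _ h0)

/-! ### Euclidean weights modulo 8 -/

def qf (a : ZMod 4) : ZMod 8 := if a = 0 then 0 else if a = 2 then 4 else 1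

def dbl : ZMod 4 →+ ZMod 8 where
  toFun a := 2 * (a.val : ZMod 8)
  map_zero' := by decide
  map_add' := by decide

theorem qf_add : ∀ a b : ZMod 4, qf (a + b) = qf a + qf b + dbl (a * b) := by decide

theorem qf_mul : ∀ a b : ZMod 4, qf (a * b) = qf a * qf b := by decide

theorem qf_even : ∀ a : ZMod 4, redHom a = 0 → qf a = dbl (a * 1) := by decide

def Q (x : V4) : ZMod 8 := ∑ i, qf (x i)

theorem euclWt_cast (x : V4) : ((euclWt x : ℕ) : ZMod 8) = Q x := by
  unfold euclWt Q
  rw [Nat.cast_sum]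
  refine Finset.sum_congr rfl fun i _ => ?_
  unfold qf
  split_ifs <;> simp

theorem Q_add (x y : V4) : Q (x + y) = Q x + Q y + dbl (z4Inner x y) := by
  unfold Q z4Inner
  rw [map_sum, ← Finset.sum_add_distrib, ← Finset.sum_add_distrib]
  exact Finset.sum_congr rfl fun i _ => qf_add _ _

theorem Q_smul (a : ZMod 4) (x : V4) : Q (a • x) = qf a * Q x := by
  unfold Q
  rw [Finset.mul_sum]
  exact Finset.sum_congr rfl fun i _ => qf_mul _ _

theorem code_typeII {S : Set V4} (hS : ∀ s ∈ S, ∀ t ∈ S, z4Inner s t = 0)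
    (hq : ∀ s ∈ S, 8 ∣ euclWt s) (h1 : (fun _ => 1 : V4) ∈ S) :
    IsTypeIIZ4 (code S : Set V4) := by
  refine ⟨code_selfdual hS, fun x hx => ?_⟩
  rw [← ZMod.natCast_eq_zero_iff, euclWt_cast]
  have hspan : ∀ s ∈ Submodule.span (ZMod 4) S, Q s = 0 := by
    intro s hs
    induction hs using Submodule.span_induction with
    | mem s hs =>
      rw [← euclWt_cast]
      exact (ZMod.natCast_eq_zero_iff _ _).2 (hq s hs)
    | zero => simp [Q, qf]
    | add a b ha hb hqa hqb =>
      rw [Q_add, hqa, hqb, code_selforth hS (span_le_code hS ha) (span_le_code hS hb)]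
      simp
    | smul c a _ ha => rw [Q_smul, ha, mul_zero]
  obtain ⟨s, hs, d, hd, hd0, rfl⟩ := code_decomp hS hx
  rw [Q_add, hspan s hs, code_selforth hS (span_le_code hS hs) hd]
  have hQd : Q d = dbl (z4Inner d (fun _ => 1)) := by
    unfold Q z4Inner
    rw [map_sum]
    exact Finset.sum_congr rfl fun i _ => qf_even _ (congrFun hd0 i)
  rw [hQd, hd.1 _ h1]
  simp

/-! ### Residues and monomial equivalence -/

theorem red_image_code {S : Set V4} (hS : ∀ s ∈ S, ∀ t ∈ S, z4Inner s t = 0) :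
    red '' (code S : Set V4) = (Submodule.span (ZMod 2) (red '' S) : Set V2) := by
  apply Set.Subset.antisymm
  · rintro _ ⟨x, hx, rfl⟩
    exact hx.2
  · intro y hy
    obtain ⟨s, hs, rfl⟩ := exists_lift hy
    exact ⟨s, span_le_code hS hs, rfl⟩

/-- Number of residue codewords of weight 20. -/
noncomputable def inv20 (C : Set V4) : ℕ := Set.ncard {y | y ∈ red '' C ∧ hWt y = 20}

theorem hWt_comp (σ : Equiv.Perm (Fin 64)) (y : V2) : hWt (fun i => y (σ i)) = hWt y := by
  unfold hWt
  apply Finset.card_bij (fun i _ => σ i)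
  · intro i hi; simpa using hi
  · intro a _ b _ h; exact σ.injective h
  · intro b hb; exact ⟨σ.symm b, by simpa using hb, by simp⟩

theorem inv20_equiv {C D : Set V4} (h : MonomiallyEquiv C D) : inv20 C = inv20 D := by
  obtain ⟨σ, ε, hε, rfl⟩ := h
  have hred : ∀ x : V4, red (fun i => ε i * x (σ i)) = fun i => red x (σ i) := by
    intro x
    funext i
    have key : ∀ a b : ZMod 4, (a = 1 ∨ a = 3) → redHom (a * b) = redHom b := by decide
    exact key _ _ (hε i)
  unfold inv20
  have hinj : Function.Injective (fun (y : V2) (i : Fin 64) => y (σ i)) := by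
    intro a b hab
    funext i
    have := congrFun hab (σ.symm i)
    simpa using this
  rw [← Set.ncard_image_of_injective _ hinj]
  congr 1
  ext y
  constructor
  · rintro ⟨_, ⟨⟨x, hx, rfl⟩, hw⟩, rfl⟩
    exact ⟨⟨_, ⟨x, hx, rfl⟩, hred x⟩, by rw [← hw]; exact hWt_comp σ (red x)⟩
  · rintro ⟨⟨_, ⟨x, hx, rfl⟩, rfl⟩, hw⟩
    refine ⟨red x, ⟨⟨x, hx, rfl⟩, ?_⟩, (hred x).symm⟩
    rw [← hw]
    dsimp only
    rw [hred x, hWt_comp σ (red x)]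

/-! ### Vectors encoded by natural numbers -/

def pcT : ℕ :=
  95125173855764218123276304889944061997689682402263585766959741291920687686033329201817409157123347502415384089435969498586180241031507595463600295898153685276653211633572815512294064538494957912327413386667662218713394765509704508661031522276467630197481635010039778342554499416459730172574551513689147646224

def apnT : ℕ :=
  8250620362711487853439470165051479814762532630333680074880726185192103892019293053439235745437768453649641651339328


def pcb (b : ℕ) : ℕ := pcT / 2 ^ (4 * b) % 16

def pc (n : ℕ) : ℕ :=
  pcb (n % 256) + pcb (n / 2 ^ 8 % 256) + pcb (n / 2 ^ 16 % 256) + pcb (n / 2 ^ 24 % 256) +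
  pcb (n / 2 ^ 32 % 256) + pcb (n / 2 ^ 40 % 256) + pcb (n / 2 ^ 48 % 256) +
  pcb (n / 2 ^ 56 % 256)

def pcTraw : ℕ :=
  nat_lit 95125173855764218123276304889944061997689682402263585766959741291920687686033329201817409157123347502415384089435969498586180241031507595463600295898153685276653211633572815512294064538494957912327413386667662218713394765509704508661031522276467630197481635010039778342554499416459730172574551513689147646224

/-- The same popcount, written with raw literals, for fast evaluation. -/
def pcRaw (n : ℕ) : ℕ :=
  Nat.add (Nat.add (Nat.add (Nat.add (Nat.add (Nat.add (Nat.add (Nat.mod (Nat.div pcTraw (Nat.pow (nat_lit 2) (Nat.mul (nat_lit 4) (Nat.mod n (nat_lit 256))))) (nat_lit 16))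
    (Nat.mod (Nat.div pcTraw (Nat.pow (nat_lit 2) (Nat.mul (nat_lit 4) (Nat.mod (Nat.div n (nat_lit 256)) (nat_lit 256))))) (nat_lit 16)))
    (Nat.mod (Nat.div pcTraw (Nat.pow (nat_lit 2) (Nat.mul (nat_lit 4) (Nat.mod (Nat.div n (nat_lit 65536)) (nat_lit 256))))) (nat_lit 16)))
    (Nat.mod (Nat.div pcTraw (Nat.pow (nat_lit 2) (Nat.mul (nat_lit 4) (Nat.mod (Nat.div n (nat_lit 16777216)) (nat_lit 256))))) (nat_lit 16)))
    (Nat.mod (Nat.div pcTraw (Nat.pow (nat_lit 2) (Nat.mul (nat_lit 4) (Nat.mod (Nat.div n (nat_lit 4294967296)) (nat_lit 256))))) (nat_lit 16)))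
    (Nat.mod (Nat.div pcTraw (Nat.pow (nat_lit 2) (Nat.mul (nat_lit 4) (Nat.mod (Nat.div n (nat_lit 1099511627776)) (nat_lit 256))))) (nat_lit 16)))
    (Nat.mod (Nat.div pcTraw (Nat.pow (nat_lit 2) (Nat.mul (nat_lit 4) (Nat.mod (Nat.div n (nat_lit 281474976710656)) (nat_lit 256))))) (nat_lit 16)))
    (Nat.mod (Nat.div pcTraw (Nat.pow (nat_lit 2) (Nat.mul (nat_lit 4) (Nat.mod (Nat.div n (nat_lit 72057594037927936)) (nat_lit 256))))) (nat_lit 16))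

theorem pcRaw_eq (n : ℕ) : pcRaw n = pc n := by
  have h : pcT = pcTraw := rfl
  unfold pc pcb
  rw [h]
  rfl

theorem pcb_eq : ∀ b < 256, pcb b = ∑ i ∈ Finset.range 8, (b.testBit i).toNat := by
  decide +kernel

theorem pcb_shift (n k : ℕ) :
    pcb (n / 2 ^ k % 256) = ∑ i ∈ Finset.range 8, (n.testBit (k + i)).toNat := by
  rw [pcb_eq _ (Nat.mod_lt _ (by norm_num))]
  refine Finset.sum_congr rfl fun i hi => ?_
  have h : i < 8 := Finset.mem_range.1 hi
  rw [show 256 = 2 ^ 8 by norm_num, Nat.testBit_mod_two_pow, Nat.testBit_div_two_pow]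
  simp [h, add_comm]

theorem pc_eq (n : ℕ) : pc n = ∑ i : Fin 64, (n.testBit i).toNat := by
  rw [Fin.sum_univ_eq_sum_range (fun i => (n.testBit i).toNat) 64]
  have h0 := pcb_shift n 0
  rw [pow_zero, Nat.div_one] at h0
  unfold pc
  rw [h0, pcb_shift, pcb_shift, pcb_shift, pcb_shift, pcb_shift, pcb_shift, pcb_shift]
  simp only [Finset.sum_range_succ, Finset.sum_range_zero]
  ring_nf

def bv (n : ℕ) : V2 := fun i => if n.testBit i then 1 else 0

def zv (p : ℕ × ℕ) : V4 := fun i =>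
  (if p.1.testBit i then 1 else 0) + (if p.2.testBit i then 2 else 0)

theorem red_zv (p : ℕ × ℕ) : red (zv p) = bv p.1 := by
  funext i
  unfold red zv bv
  cases p.1.testBit i <;> cases p.2.testBit i <;> decide

theorem bv_zero : bv 0 = 0 := by
  funext i; simp [bv]

theorem bv_xor (a b : ℕ) : bv (a ^^^ b) = bv a + bv b := by
  funext i
  simp only [bv, Nat.testBit_xor, Pi.add_apply]
  cases a.testBit i <;> cases b.testBit i <;> decide

theorem hWt_bv (n : ℕ) : hWt (bv n) = pc n := by
  rw [pc_eq, hWt, Finset.card_filter]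
  refine Finset.sum_congr rfl fun i _ => ?_
  unfold bv
  cases n.testBit i <;> simp

theorem bv_inj {a b : ℕ} (ha : a < 2 ^ 64) (hb : b < 2 ^ 64) (h : bv a = bv b) : a = b := by
  apply Nat.eq_of_testBit_eq
  intro i
  by_cases hi : i < 64
  · have := congrFun h ⟨i, hi⟩
    simp only [bv] at this
    revert this
    cases a.testBit i <;> cases b.testBit i <;> decide
  · have h2 : (2:ℕ) ^ 64 ≤ 2 ^ i := Nat.pow_le_pow_right (by norm_num) (by omega)
    rw [Nat.testBit_lt_two_pow (lt_of_lt_of_le ha h2),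
      Nat.testBit_lt_two_pow (lt_of_lt_of_le hb h2)]

def ipN (p q : ℕ × ℕ) : ℕ :=
  pc (p.1 &&& q.1) + 2 * pc (p.1 &&& q.2) + 2 * pc (p.2 &&& q.1)

theorem inner_zv (p q : ℕ × ℕ) : z4Inner (zv p) (zv q) = (ipN p q : ℕ) := by
  unfold ipN z4Inner zv
  rw [pc_eq, pc_eq, pc_eq]
  push_cast
  rw [Finset.mul_sum, Finset.mul_sum, ← Finset.sum_add_distrib, ← Finset.sum_add_distrib]
  refine Finset.sum_congr rfl fun i _ => ?_
  simp only [Nat.testBit_and]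
  cases p.1.testBit i <;> cases p.2.testBit i <;> cases q.1.testBit i <;>
    cases q.2.testBit i <;> decide

theorem euclWt_zv (p : ℕ × ℕ) :
    euclWt (zv p) + 4 * pc (p.1 &&& p.2) = pc p.1 + 4 * pc p.2 := by
  unfold euclWt zv
  rw [pc_eq, pc_eq, pc_eq, Finset.mul_sum, Finset.mul_sum, ← Finset.sum_add_distrib,
    ← Finset.sum_add_distrib]
  refine Finset.sum_congr rfl fun i _ => ?_
  simp only [Nat.testBit_and]
  cases p.1.testBit i <;> cases p.2.testBit i <;> decide

/-- All words of the coset of `acc`. -/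
def words : List ℕ → ℕ → List ℕ
  | [], acc => [acc]
  | g :: gs, acc => words gs acc ++ words gs (Nat.xor acc g)

/-- All words of weight at most 20 of the coset of `acc`. -/
def light : List ℕ → ℕ → List ℕ
  | [], acc => bif Nat.ble (pcRaw acc) (nat_lit 20) then [acc] else []
  | g :: gs, acc => List.append (light gs acc) (light gs (Nat.xor acc g))

theorem light_eq (gs : List ℕ) : ∀ acc w, w ∈ light gs acc ↔ w ∈ words gs acc ∧ pc w ≤ 20 := by
  induction gs with
  | nil =>
    intro acc w
    simp only [light, words, List.mem_singleton]
    rw [pcRaw_eq]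
    cases h : Nat.ble (pc acc) 20
    · have h' : ¬ pc acc ≤ 20 := fun hh => by
        rw [Nat.ble_eq_true_of_le hh] at h; cases h
      simp only [cond_false, List.not_mem_nil, false_iff]
      rintro ⟨rfl, hw⟩
      exact h' hw
    · have h' : pc acc ≤ 20 := Nat.le_of_ble_eq_true h
      simp only [cond_true, List.mem_singleton]
      constructor
      · rintro rfl; exact ⟨rfl, h'⟩
      · exact fun hh => hh.1
  | cons g gs ih =>
    intro acc w
    show w ∈ light gs acc ++ light gs (acc ^^^ g) ↔ w ∈ words gs acc ++ words gs (acc ^^^ g) ∧ _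
    simp only [List.mem_append, ih]
    tauto

theorem two_cases : ∀ a : ZMod 2, a = 0 ∨ a = 1 := by decide

theorem exists_word (gs : List ℕ) : ∀ (acc : ℕ) (y : V2),
    y ∈ Submodule.span (ZMod 2) (bv '' {a | a ∈ gs}) → ∃ w ∈ words gs acc, bv w = bv acc + y := by
  induction gs with
  | nil =>
    intro acc y hy
    have : y = 0 := by simpa using hy
    exact ⟨acc, by simp [words], by rw [this, add_zero]⟩
  | cons g gs ih =>
    intro acc y hy
    have hset : bv '' {a | a ∈ g :: gs} = insert (bv g) (bv '' {a | a ∈ gs}) := by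
      rw [← Set.image_insert_eq]
      congr 1
      ext a
      simp
    rw [hset, Submodule.mem_span_insert] at hy
    obtain ⟨a, z, hz, rfl⟩ := hy
    rcases two_cases a with rfl | rfl
    · obtain ⟨w, hw, hw'⟩ := ih acc z hz
      exact ⟨w, List.mem_append_left _ hw, by rw [hw', zero_smul, zero_add]⟩
    · obtain ⟨w, hw, hw'⟩ := ih (acc ^^^ g) z hz
      exact ⟨w, List.mem_append_right _ hw, by rw [hw', one_smul, bv_xor, add_assoc]⟩

theorem word_mem (gs : List ℕ) (P : Submodule (ZMod 2) V2) (hP : ∀ a ∈ gs, bv a ∈ P) :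
    ∀ (acc w : ℕ), bv acc ∈ P → w ∈ words gs acc → bv w ∈ P := by
  induction gs with
  | nil =>
    intro acc w hacc hw
    have : w = acc := by simpa [words] using hw
    rw [this]; exact hacc
  | cons g gs ih =>
    intro acc w hacc hw
    have ih' := ih fun a ha => hP a (List.mem_cons_of_mem _ ha)
    rcases List.mem_append.1 hw with hw | hw
    · exact ih' acc w hacc hw
    · refine ih' (acc ^^^ g) w ?_ hw
      rw [bv_xor]
      exact Submodule.add_mem _ hacc (hP g List.mem_cons_self)

/-! ### The concrete codes -/

def baseRows : List (ℕ × ℕ) :=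
  [(18446744073709551615, 0),
   (12297829382473034410, 0),
   (14757395258967641292, 0),
   (17361641481138401520, 0),
   (18374966859414961920, 0),
   (18446462603027742720, 0),
   (18446744069414584320, 0),
   (18398668366885285978, 13889101250810609664),
   (2471331023425957496, 17293822569102704640),
   (9389679854624826408, 0),
   (17341842382225304012, 9838113385990848512),
   (6004359585257135968, 18212556893086285824),
   (3459821092891266240, 4938196991411748864)]

def extraRow : Fin 9 → ℕ × ℕ :=
  ![(16959513381754972583, 10392196877645774848),
    (4066568636838857796, 9241386435364257792),
    (6192496854287616462, 3756019683560521728),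
    (13482517662440949449, 6648438949905694720),
    (8588744706729403816, 340021774013956096),
    (5173589482120051781, 452752502186573824),
    (5211293120899668564, 17588949082183827456),
    (6781438838981797917, 7313845796997169152),
    (8092469606327642391, 4332603579018772480)]

def lightWords : Fin 9 → List ℕ :=
  ![[654200903087837833,
     727331893902821139,
     14303714076428469381,
     221063540070416937,
     5078043855225301,
     9340543735773141249,
     9318196806389166183,
     1443833630531266050,
     10064052031087452216,
     3897865762375356742,
     2649842058775369266,
     4954103168767658292,
     11971353009602495040,
     883838171347260442,
     4758743845460672526,
     14704991733855292950,
     51854145259048560,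
     2377927723834051218,
     1249445157582440712,
     13856178647298011712,
     4757438402016646760,
     903077862662449386,
     3497150988611338560,
     2432828540182601732,
     32827326805127808,
     12781290537291890856,
     5801086175767939104,
     1325773530481314052,
     7193374661988632646,
     3256174207358282760],
    [5053856956106757264,
     9621980759948604000,
     9909117510618497388,
     1910050799255864320,
     11011025116889161768,
     315252835932222344,
     1531869627360020480,
     1590917167082243238,
     12105777671108825112,
     6341338764400429454,
     4671396211071191100,
     5863798882773767800,
     1190231550673982624,
     8346446105657214720,
     3631396996591422082,
     8971470899274411724,
     1402897811255093340,
     9260109102260195888,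
     12511053164730925074,
     16192722218428684448,
     3530980493772867028,
     3603730279589496360,
     328944615137748241,
     1838111314292848643,
     621500079510946699,
     7425527593899690561,
     9255497019343504553,
     9475029632609784115,
     75446650337304717,
     9229129409387612163,
     2310700790577218131,
     13980106465420779585],
    [1459461208289707084,
     2612707017233336460,
     9747074688798818592,
     16434924769625281152,
     7566172177379330306,
     1779650112180979776,
     11024852401374892180,
     1689131349410169920,
     448746850455921924,
     6210607379194126500,
     15529027242764089456,
     5201270937193981996,
     23965041575283202,
     11551753353262678098,
     25895205684568,
     10378229860131685320,
     11242428474782525090,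
     13836045571569930254,
     3459653474093255064,
     2471075460843481888,
     4691347573326493824,
     865579819932327986,
     5795152103026494546,
     9428496926773871804,
     2415067163426657324,
     2900866817017025049,
     4950804679209779475,
     361715647454940305,
     7349914342630887531,
     3462298155255209985,
     7178817044073955425,
     5610077812980975747,
     2459538707116527123],
    [360449393377903633,
     8652579301571626501,
     435901453993906571,
     12204809141395662721,
     775468551964346385,
     7782232390320932939,
     2384691878576148729,
     5764620593324892641,
     3040702523057217,
     45037205401949211,
     9332791040375810307,
     9377128122472467651,
     720638107883871608,
     4107443470843646532,
     7640851432370934808,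
     9530313921820363356,
     428062440035979912,
     2614142119214383116,
     3862407396362306692,
     1500405672916134144,
     2848597854747508480,
     10026285532564398176,
     15602791651579641856,
     13836749668048033934,
     10592734744005396660,
     22699088077406850,
     1303944066992480314,
     8233777275544315392,
     3485788401074081202,
     1264684888708482570,
     6935270817069696840,
     15171800346263523488,
     10406289508244394372,
     6683350832441987554],
    [756747512872534400,
     16484406712074242466,
     9830003397624464276,
     2884284016424342280,
     4900643180559247716,
     9847133789482952962,
     1730567547717181384,
     13478482761124724738,
     9515642023023192660,
     15074111117519575602,
     4783474410020425732,
     228707803661083270,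
     1253309123887415358,
     5992343046491058496,
     1279356756367353346,
     2378238417027727444,
     10425904946230072384,
     9296561380445981188,
     869227904692457862,
     8216923946751297032,
     6935629464026473648,
     16289122189776126104,
     5230930974765023323,
     396364597082265833,
     1481972701741080721,
     9854161187898592305,
     2937531167846041185,
     2812504594582625287,
     14213503536922634025,
     6929141133499187587,
     2420854060079959041,
     253965268278193443,
     11272582986727695427,
     9209825154189539,
     20627734996783663],
    [9741323996418938387,
     3927509281781449223,
     3128948409323544597,
     7316100979332547675,
     6145161796310573581,
     727336917979650055,
     2596961154954447401,
     9323437929751653507,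
     15132976595265941523,
     13854293083523908813,
     12871542822807832873,
     3463777273260446209,
     5330535485120193,
     10381930219530655825,
     2897293787946583338,
     9569102495823697168,
     443706303404310882,
     9828337267871023136,
     14592442932197327108,
     443329831488755460,
     688312837614993864,
     2905688815194622336,
     1730816020724664858,
     16431901937226489984,
     16226488398759805728,
     10416170951367742468,
     2420142328435290186,
     5774752188418044168,
     2089918738472139820,
     4685503943898073728,
     15060116746218933264,
     6852398499968320008,
     3522260490824778904,
     11547803469685613620,
     869529154290451540,
     9298400511671896496],
    [2882773420553390600,
     5190489042218894184,
     14272054597722918256,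
     379791451732694144,
     1483937349458759688,
     12213902980779610412,
     394497420137103638,
     7674274709224916870,
     657561086871502144,
     9296089892048900868,
     2451089079106837160,
     3480202846576867344,
     1299395290112131086,
     9320254069551794744,
     6922912277375251178,
     9299091190178645346,
     17521958051082543632,
     12452533854653851712,
     2477632129316443650,
     900803922695040330,
     37027520631162912,
     3494877589004240096,
     10385321661074319500,
     3685720206739317024,
     411252555079893529,
     668373741781667349,
     1754155246162059275,
     5143401642561634509,
     5202943207988095233,
     7386818184864865555,
     7360788237026421,
     11533918345583138883,
     2423507390289674391,
     2218195512836763661,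
     13871339754087326345,
     5802343432804901913,
     39451577875833273],
    [208609551688147377,
     162209321605285773,
     9227471636826399653,
     954795148611821851,
     16196257079161520211,
     7070723372926047265,
     4653432322501379417,
     9657870075760738313,
     8434046041887738885,
     4974226627932324037,
     3784752222488548369,
     9440284035022703040,
     2306972934293602412,
     16143036316345521466,
     11694199250747401284,
     210125592750475304,
     9269635127893404672,
     8113293741928243200,
     108333857454231832,
     1180390149581832198,
     2536669630794104928,
     3638991547813338660,
     13601443747866282240,
     10529438091771605576,
     3211572310412099786,
     5045210275501075104,
     10682589391909587752,
     13404964550868074554,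
     509048698847265054,
     293600999237518050,
     8721220678996170384,
     581011914534545288,
     1653112847272677376,
     6059180174341378340,
     2968329783555150016,
     297363847526105362,
     321234696799276616,
     5373076196240239110],
    [9245486093518860417,
     144194946919601321,
     1173299859223508497,
     5931267257212602421,
     6991135994693224531,
     13907317173884944899,
     75567553319338291,
     10124432828116576539,
     3207689283889013579,
     1022335876925174323,
     11628365981576876463,
     2315599612515459101,
     2744949491662733377,
     2960846322380484785,
     3063169059531265665,
     4075801918407273733,
     936998107860700608,
     4396395196882878720,
     9229008485707617858,
     211929906356945456,
     9241890238262024472,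
     4630439709661629518,
     2324987326159393608,
     2318523406388578692,
     115554464103488256,
     3559611858869135552,
     4864721061784134948,
     1407428122101948548,
     4621830462321541348,
     6341213531542431792,
     14145948447265899664,
     9660900435292595080,
     10894245179450300416,
     633179609879283462,
     14151181393373955936,
     8561625019620331656,
     1549525592248386344,
     7222850350582109196,
     10694115194916438720]]

def lightCount : Fin 9 → ℕ := ![30, 32, 33, 34, 35, 36, 37, 38, 39]

def baseRes : List ℕ := baseRows.map Prod.fst

def gens (i : Fin 9) : List (ℕ × ℕ) := extraRow i :: baseRows

def gset (i : Fin 9) : Set V4 := zv '' {p | p ∈ gens i}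

def wit : ℕ × ℕ := (0, 21990232555559)

theorem gens_orth : ∀ i, ∀ p ∈ gens i, ∀ q ∈ gens i, ipN p q % 4 = 0 := by decide +kernel

theorem gens_norm : ∀ i, ∀ p ∈ gens i,
    (pc p.1 + 4 * pc p.2) % 8 = 4 * pc (p.1 &&& p.2) % 8 := by decide +kernel

theorem wit_orth : ∀ i, ∀ q ∈ gens i, ipN wit q % 4 = 0 := by decide +kernel

theorem wit_wt : pc wit.2 = 6 := by decide +kernel

theorem gset_orth (i : Fin 9) : ∀ s ∈ gset i, ∀ t ∈ gset i, z4Inner s t = 0 := by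
  rintro _ ⟨p, hp, rfl⟩ _ ⟨q, hq, rfl⟩
  rw [inner_zv]
  exact (ZMod.natCast_eq_zero_iff _ _).2 (Nat.dvd_of_mod_eq_zero (gens_orth i p hp q hq))

theorem gset_norm (i : Fin 9) : ∀ s ∈ gset i, 8 ∣ euclWt s := by
  rintro _ ⟨p, hp, rfl⟩
  have h1 := euclWt_zv p
  have h2 := gens_norm i p hp
  omega

theorem one_mem_gset (i : Fin 9) : (fun _ => 1 : V4) ∈ gset i := by
  refine ⟨(18446744073709551615, 0), ?_, ?_⟩
  · show _ ∈ gens i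
    simp [gens, baseRows]
  · funext j
    have : ∀ j : Fin 64, Nat.testBit 18446744073709551615 j = true := by decide +kernel
    simp only [zv, this j]
    simp

theorem typeII (i : Fin 9) : IsTypeIIZ4 (code (gset i) : Set V4) :=
  code_typeII (gset_orth i) (gset_norm i) (one_mem_gset i)

theorem red_gset (i : Fin 9) : red '' gset i = bv '' {a | a ∈ (extraRow i).1 :: baseRes} := by
  have h : ((extraRow i).1 :: baseRes) = (gens i).map Prod.fst := rfl
  rw [h]
  unfold gset
  ext y
  constructor
  · rintro ⟨_, ⟨p, hp, rfl⟩, rfl⟩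
    exact ⟨p.1, List.mem_map_of_mem hp, (red_zv p).symm⟩
  · rintro ⟨a, ha, rfl⟩
    obtain ⟨p, hp, rfl⟩ := List.mem_map.1 ha
    exact ⟨_, ⟨p, hp, rfl⟩, red_zv p⟩

theorem light_base : light baseRes 0 = [0] := by decide +kernel

theorem light_extra : ∀ i, light baseRes (extraRow i).1 = lightWords i := by decide +kernel

theorem lightWords_nodup : ∀ i, (lightWords i).Nodup := by decide +kernel

theorem lightWords_length : ∀ i, (lightWords i).length = lightCount i := by decide +kernel

theorem lightWords_wt : ∀ i, ∀ w ∈ lightWords i, w < 2 ^ 64 ∧ pc w = 20 := by decide +kernel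

theorem light_all (i : Fin 9) :
    light ((extraRow i).1 :: baseRes) 0 = 0 :: lightWords i := by
  show light baseRes 0 ++ light baseRes (0 ^^^ (extraRow i).1) = _
  rw [light_base, Nat.zero_xor, light_extra]
  rfl

theorem res_light (i : Fin 9) {y : V2} (hy : y ∈ Submodule.span (ZMod 2) (red '' gset i))
    (hw : hWt y ≤ 20) : y = 0 ∨ ∃ w ∈ lightWords i, y = bv w := by
  rw [red_gset] at hy
  obtain ⟨w, hw1, hw2⟩ := exists_word _ 0 y hy
  rw [bv_zero, zero_add] at hw2
  subst hw2
  rw [hWt_bv] at hw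
  have := (light_eq _ 0 w).2 ⟨hw1, hw⟩
  rw [light_all] at this
  rcases List.mem_cons.1 this with rfl | h
  · exact Or.inl bv_zero
  · exact Or.inr ⟨w, h, rfl⟩

theorem inv20_code (i : Fin 9) : inv20 (code (gset i) : Set V4) = lightCount i := by
  unfold inv20
  rw [red_image_code (gset_orth i)]
  have hset : {y : V2 | y ∈ (Submodule.span (ZMod 2) (red '' gset i) : Set V2) ∧ hWt y = 20} =
      (((lightWords i).toFinset.image bv : Finset V2) : Set V2) := by
    ext y
    simp only [Set.mem_ofPred_eq, SetLike.mem_coe, Finset.coe_image, Set.mem_image,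
      List.coe_toFinset]
    constructor
    · rintro ⟨hy, hw⟩
      rcases res_light i hy hw.le with rfl | ⟨w, hwl, rfl⟩
      · simp [hWt] at hw
      · exact ⟨w, hwl, rfl⟩
    · rintro ⟨w, hw, rfl⟩
      have h20 := (lightWords_wt i w hw).2
      refine ⟨?_, by rw [hWt_bv, h20]⟩
      have hmem : w ∈ light ((extraRow i).1 :: baseRes) 0 := by
        rw [light_all]; exact List.mem_cons_of_mem _ hw
      rw [red_gset]
      refine word_mem _ _ (fun a ha => Submodule.subset_span (Set.mem_image_of_mem bv ha)) 0 w ?_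
        ((light_eq _ 0 w).1 hmem).1
      rw [bv_zero]; exact Submodule.zero_mem _
  rw [hset, Set.ncard_coe_finset, Finset.card_image_of_injOn, List.toFinset_card_of_nodup
    (lightWords_nodup i), lightWords_length]
  intro a ha b hb hab
  have ha' : a ∈ lightWords i := by simpa using ha
  have hb' : b ∈ lightWords i := by simpa using hb
  exact bv_inj (lightWords_wt i a ha').1 (lightWords_wt i b hb').1 hab

/-! ### Dual distance, from the APN function -/

def apn (x : ℕ) : ℕ := apnT / 2 ^ (6 * x) % 64

theorem row_idx : ∀ r < 6, ∃ p ∈ baseRows, ∀ j < 64, p.1.testBit j = Nat.testBit j r := by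
  decide +kernel

theorem row_apn : ∀ r < 6, ∃ p ∈ baseRows, ∀ j < 64, p.1.testBit j = Nat.testBit (apn j) r := by
  decide +kernel

theorem apn_check : ∀ l < 64, ∀ k < l, ∀ j < k,
    apn j ^^^ apn k ^^^ apn l ^^^ apn (j ^^^ k ^^^ l) ≠ 0 := by
  decide +kernel

theorem xor_zero_of_bits (f : ℕ → ℕ) (hf : ∀ j < 64, f j < 64) (L : List ℕ)
    (hL : ∀ j ∈ L, j < 64)
    (h : ∀ r < 6, (L.map fun j => (f j).testBit r).foldr xor false = false) :
    (L.map f).foldr (· ^^^ ·) 0 = 0 := by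
  have hbit : ∀ (M : List ℕ) (r : ℕ), ((M.map f).foldr (· ^^^ ·) 0).testBit r =
      (M.map fun j => (f j).testBit r).foldr xor false := by
    intro M r
    induction M with
    | nil => simp
    | cons a M ih => simp [Nat.testBit_xor, ih]
  apply Nat.eq_of_testBit_eq
  intro r
  rw [hbit, Nat.zero_testBit]
  by_cases hr : r < 6
  · exact h r hr
  · have h2 : (2:ℕ) ^ 6 ≤ 2 ^ r := Nat.pow_le_pow_right (by norm_num) (by omega)
    clear h
    induction L with
    | nil => rfl
    | cons a M ih =>
      have ha : (f a).testBit r = false :=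
        Nat.testBit_lt_two_pow (lt_of_lt_of_le (hf a (hL a List.mem_cons_self)) h2)
      simp only [List.map_cons, List.foldr_cons, ha, Bool.false_xor]
      exact ih fun j hj => hL j (List.mem_cons_of_mem _ hj)

theorem apn_lt (j : ℕ) : apn j < 64 := Nat.mod_lt _ (by norm_num)

theorem inner_even (i : Fin 9) {x : V4} (hx : x ∈ code (gset i)) (h0 : red x = 0)
    {p : ℕ × ℕ} (hp : p ∈ baseRows) :
    ∑ j ∈ Finset.univ.filter (fun j => x j = 2),
      (if p.1.testBit j then (2 : ZMod 4) else 0) = 0 := by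
  have h := hx.1 (zv p) ⟨p, List.mem_cons_of_mem _ hp, rfl⟩
  refine Eq.trans ?_ h
  rw [Finset.sum_filter]
  unfold z4Inner zv
  refine Finset.sum_congr rfl fun j _ => ?_
  have hj : redHom (x j) = 0 := congrFun h0 j
  revert hj
  generalize x j = a
  cases p.1.testBit j <;> cases p.2.testBit j <;> revert a <;> decide

theorem euclWt_even {x : V4} (h0 : red x = 0) :
    euclWt x = 4 * (Finset.univ.filter (fun j => x j = 2)).card := by
  rw [Finset.card_filter, Finset.mul_sum]
  unfold euclWt
  refine Finset.sum_congr rfl fun j _ => ?_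
  have hj : redHom (x j) = 0 := congrFun h0 j
  revert hj
  generalize x j = a
  revert a
  decide

theorem dual_distance (T : Finset (Fin 64))
    (hT : ∀ p ∈ baseRows, ∑ j ∈ T, (if p.1.testBit j then (2 : ZMod 4) else 0) = 0) :
    T.card ≠ 2 ∧ T.card ≠ 4 := by
  constructor
  · intro hc
    obtain ⟨a, b, hab, rfl⟩ := Finset.card_eq_two.1 hc
    have h := xor_zero_of_bits (fun j => j) (fun j hj => hj) [a.1, b.1] (by simp) (by
      intro r hr
      obtain ⟨p, hp, hpr⟩ := row_idx r hr
      have h := hT p hp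
      rw [Finset.sum_pair hab, hpr a a.2, hpr b b.2] at h
      revert h
      simp only [List.map_cons, List.map_nil, List.foldr_cons, List.foldr_nil]
      cases Nat.testBit a r <;> cases Nat.testBit b r <;> decide)
    simp only [List.map_cons, List.map_nil, List.foldr_cons, List.foldr_nil, Nat.xor_zero] at h
    exact hab (Fin.ext (Nat.xor_eq_zero_iff.1 h))
  · intro hc
    set e := T.orderEmbOfFin hc with he
    have hsum : ∀ F : Fin 64 → ZMod 4, ∑ j ∈ T, F j = F (e 0) + (F (e 1) + (F (e 2) + F (e 3))) := by
      intro F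
      have himg : T = Finset.univ.map e.toEmbedding := by
        rw [he, Finset.map_orderEmbOfFin_univ]
      rw [himg, Finset.sum_map, Fin.sum_univ_four]
      simp only [add_assoc]
      rfl
    have h01 : e 0 < e 1 := e.strictMono (by decide)
    have h12 : e 1 < e 2 := e.strictMono (by decide)
    have hbits : ∀ p ∈ baseRows, ∀ a b c d : Bool, p.1.testBit (e 0) = a → p.1.testBit (e 1) = b →
        p.1.testBit (e 2) = c → p.1.testBit (e 3) = d →
        (a ^^ (b ^^ (c ^^ (d ^^ false)))) = false := by
      intro p hp a b c d ha hb hc hd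
      have h := hT p hp
      rw [hsum, ha, hb, hc, hd] at h
      revert h
      cases a <;> cases b <;> cases c <;> cases d <;> decide
    have h1 := xor_zero_of_bits (fun j => j) (fun j hj => hj)
      [(e 0).1, (e 1).1, (e 2).1, (e 3).1] (by simp) (by
      intro r hr
      obtain ⟨p, hp, hpr⟩ := row_idx r hr
      exact hbits p hp _ _ _ _ (hpr _ (e 0).2) (hpr _ (e 1).2) (hpr _ (e 2).2) (hpr _ (e 3).2))
    have h2 := xor_zero_of_bits apn (fun j _ => apn_lt j)
      [(e 0).1, (e 1).1, (e 2).1, (e 3).1] (by simp) (by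
      intro r hr
      obtain ⟨p, hp, hpr⟩ := row_apn r hr
      exact hbits p hp _ _ _ _ (hpr _ (e 0).2) (hpr _ (e 1).2) (hpr _ (e 2).2) (hpr _ (e 3).2))
    simp only [List.map_cons, List.map_nil, List.foldr_cons, List.foldr_nil, Nat.xor_zero,
      ← Nat.xor_assoc] at h1 h2
    have h3 := Nat.xor_eq_zero_iff.1 h1
    rw [← h3] at h2
    exact apn_check (e 2) (e 2).2 (e 1) h12 (e 0) h01 h2

theorem hWt_red_le (x : V4) : hWt (red x) ≤ euclWt x := by
  unfold hWt euclWt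
  rw [Finset.card_filter]
  refine Finset.sum_le_sum fun j _ => ?_
  show (if redHom (x j) ≠ 0 then 1 else 0) ≤ _
  generalize x j = a
  revert a
  decide

theorem min_wt (i : Fin 9) {x : V4} (hx : x ∈ code (gset i)) (hne : x ≠ 0) : 24 ≤ euclWt x := by
  have h8 : 8 ∣ euclWt x := (typeII i).2 x hx
  by_cases h0 : red x = 0
  · have hd := dual_distance _ fun p hp => inner_even i hx h0 hp
    have hw := euclWt_even h0
    have hc : (Finset.univ.filter (fun j => x j = 2)).card ≠ 0 := by
      intro hc
      rw [Finset.card_eq_zero, Finset.filter_eq_empty_iff] at hc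
      apply hne
      funext j
      have hj : redHom (x j) = 0 := congrFun h0 j
      have hj2 : ¬ x j = 2 := hc (Finset.mem_univ j)
      have key : ∀ a : ZMod 4, redHom a = 0 → ¬ a = 2 → a = 0 := by decide
      exact key _ hj hj2
    omega
  · have hle := hWt_red_le x
    have h20 : 20 ≤ hWt (red x) := by
      by_contra hlt
      rcases res_light i hx.2 (by omega) with h | ⟨w, hw, h⟩
      · exact h0 h
      · rw [h, hWt_bv, (lightWords_wt i w hw).2] at hlt
        exact hlt le_rfl
    omega

theorem wit_mem (i : Fin 9) : zv wit ∈ code (gset i) := by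
  refine ⟨?_, ?_⟩
  · rintro _ ⟨q, hq, rfl⟩
    rw [inner_zv]
    exact (ZMod.natCast_eq_zero_iff _ _).2 (Nat.dvd_of_mod_eq_zero (wit_orth i q hq))
  · rw [red_zv]
    show bv 0 ∈ _
    rw [bv_zero]; exact Submodule.zero_mem _

theorem wit_euclWt : euclWt (zv wit) = 24 := by
  have h := euclWt_zv wit
  have h1 : pc wit.1 = 0 := by decide +kernel
  have h2 : pc (wit.1 &&& wit.2) = 0 := by decide +kernel
  rw [wit_wt, h1, h2] at h
  omega

theorem extremal (i : Fin 9) : IsExtremalTypeIIZ4 64 (code (gset i) : Set V4) := by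
  refine ⟨typeII i, ?_⟩
  have hwit : 24 ∈ euclWt '' ((code (gset i) : Set V4) \ {0}) := by
    refine ⟨zv wit, ⟨wit_mem i, ?_⟩, wit_euclWt⟩
    intro h
    have h' : zv wit = 0 := h
    have h2 := wit_euclWt
    rw [h'] at h2
    simp [euclWt] at h2
  apply le_antisymm
  · exact Nat.sInf_le hwit
  · apply le_csInf ⟨_, hwit⟩
    rintro _ ⟨x, ⟨hx, hne⟩, rfl⟩
    exact min_wt i hx hne

theorem lightCount_inj : Function.Injective lightCount := by decide +kernel

end Z4Ext

theorem stmt10 : ∃ C : Fin 9 → Submodule (ZMod 4) (Fin 64 → ZMod 4),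
    (∀ i, IsExtremalTypeIIZ4 64 (C i : Set (Fin 64 → ZMod 4))) ∧
    ∀ i j, i ≠ j →
      ¬ MonomiallyEquiv (C i : Set (Fin 64 → ZMod 4)) (C j : Set (Fin 64 → ZMod 4)) := by
  refine ⟨fun i => Z4Ext.code (Z4Ext.gset i), Z4Ext.extremal, fun i j hij h => hij ?_⟩
  have h1 := Z4Ext.inv20_equiv h
  rw [Z4Ext.inv20_code, Z4Ext.inv20_code] at h1
  exact Z4Ext.lightCount_inj h1
end
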